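/- Let T be a compactly generated R-linear triangulated category that is noetherian and stratified by R. Then the map sending a thick subcategory C of T^c to supp_R C = ∪_{C∈C} supp_R C is a bijection from the collection of thick subcategories of T^c onto the collection of specialization closed subsets of supp_R T; its inverse sends a specialization closed subset V of Spec R to {C ∈ T^c | supp_R C ⊆ V}. -/

import Mathlib

open CategoryTheory CategoryTheory.Limits CategoryTheory.Pretriangulated

universe w v u u'

namespace BIK

section RingDefs

variable {R : Type u} [Ring R] (𝒜 : ℤ → AddSubgroup R) [GradedRing 𝒜]

/-- `R` is graded-commutative: `a * b = (-1)^{|a||b|} b * a` for homogeneous `a`, `b`. -/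
def IsGradedComm : Prop :=
  ∀ (i j : ℤ) (a b : R), a ∈ 𝒜 i → b ∈ 𝒜 j →
    a * b = ((-1 : ℤ) ^ (i * j).natAbs) • (b * a)

/-- A homogeneous ideal is prime if it is proper and for homogeneous elements `a`, `b`,
`a * b ∈ P` implies `a ∈ P` or `b ∈ P`. -/
structure IsHomPrime (P : HomogeneousIdeal 𝒜) : Prop where
  ne_top : P.toIdeal ≠ ⊤
  mem_or_mem : ∀ {i j : ℤ} {a b : R}, a ∈ 𝒜 i → b ∈ 𝒜 j →
    a * b ∈ P.toIdeal → a ∈ P.toIdeal ∨ b ∈ P.toIdeal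

/-- `Spec R`: the set of homogeneous prime ideals of the graded ring `R`. -/
def SpecR : Type u := {P : HomogeneousIdeal 𝒜 // IsHomPrime 𝒜 P}

variable {𝒜}

/-- `V(𝔞)`, the set of homogeneous primes containing the ideal `𝔞`. -/
def specV (𝔞 : Ideal R) : Set (SpecR 𝒜) := {p | 𝔞 ≤ p.1.toIdeal}

/-- A subset of `Spec R` is specialization closed if with any point it contains all larger
primes. -/
def SpecClosed (V : Set (SpecR 𝒜)) : Prop :=
  ∀ p q : SpecR 𝒜, p ∈ V → p.1.toIdeal ≤ q.1.toIdeal → q ∈ V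

/-- `Z(p) = { q | q ⊄ p }`. -/
def Zset (p : SpecR 𝒜) : Set (SpecR 𝒜) := {q | ¬ q.1.toIdeal ≤ p.1.toIdeal}

/-- `V(p) = { q | q ⊇ p }`. -/
def Vp (p : SpecR 𝒜) : Set (SpecR 𝒜) := {q | p.1.toIdeal ≤ q.1.toIdeal}

/-- The specialization closure of a subset of `Spec R`. -/
def specCl (U : Set (SpecR 𝒜)) : Set (SpecR 𝒜) := {p | ∃ q ∈ U, q.1.toIdeal ≤ p.1.toIdeal}

/-- The subset `U ⊆ Spec R` has finite dimension: the lengths of strict chains of primes in `U`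
are bounded. -/
def FiniteDim (U : Set (SpecR 𝒜)) : Prop :=
  ∃ n : ℕ, ∀ (m : ℕ) (c : Fin (m + 1) → SpecR 𝒜), (∀ i, c i ∈ U) →
    (StrictMono fun i => (c i).1.toIdeal) → m ≤ n

end RingDefs

section CatDefs

variable (T : Type u') [Category.{v} T] [HasZeroObject T] [Preadditive T] [HasShift T ℤ]
  [∀ n : ℤ, (CategoryTheory.shiftFunctor T n).Additive] [Pretriangulated T]
  [HasCoproducts.{v} T]

/-- The canonical map `⨁ⱼ Hom(C, fⱼ) → Hom(C, ∐ f)`. -/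
noncomputable def sigmaHom (C : T) {J : Type v} (f : J → T) :
    (DirectSum J fun j => (C ⟶ f j)) →+ (C ⟶ ∐ f) :=
  letI := Classical.decEq J
  DirectSum.toAddMonoid fun j =>
    AddMonoidHom.mk' (fun g => g ≫ Sigma.ι f j) (fun g h => by simp)

/-- An object `C` is compact if `Hom(C, -)` commutes with arbitrary coproducts. -/
def IsCompactObj (C : T) : Prop :=
  ∀ (J : Type v) (f : J → T), Function.Bijective (sigmaHom T C f)

/-- A localizing subcategory: a (strictly full) triangulated subcategory closed under
arbitrary coproducts. -/
structure IsLocalizing (S : Set T) : Prop where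
  zero_mem : ∀ X : T, Limits.IsZero X → X ∈ S
  iso_mem : ∀ {X Y : T}, (X ≅ Y) → X ∈ S → Y ∈ S
  shift_mem : ∀ X ∈ S, ∀ n : ℤ, X⟦n⟧ ∈ S
  ext_mem : ∀ Tr ∈ distTriang T, Tr.obj₁ ∈ S → Tr.obj₂ ∈ S → Tr.obj₃ ∈ S
  coprod_mem : ∀ (J : Type v) (f : J → T), (∀ j, f j ∈ S) → (∐ f) ∈ S

/-- The localizing subcategory generated by a class of objects. -/
def Loc (A : Set T) : Set T := ⋂₀ {S | IsLocalizing T S ∧ A ⊆ S}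

/-- A thick subcategory: a (strictly full) triangulated subcategory closed under
direct summands (i.e. retracts). -/
structure IsThick (S : Set T) : Prop where
  zero_mem : ∀ X : T, Limits.IsZero X → X ∈ S
  iso_mem : ∀ {X Y : T}, (X ≅ Y) → X ∈ S → Y ∈ S
  shift_mem : ∀ X ∈ S, ∀ n : ℤ, X⟦n⟧ ∈ S
  ext_mem : ∀ Tr ∈ distTriang T, Tr.obj₁ ∈ S → Tr.obj₂ ∈ S → Tr.obj₃ ∈ S
  retract_mem : ∀ X Y : T, Y ∈ S → ∀ (i : X ⟶ Y) (p : Y ⟶ X), i ≫ p = 𝟙 X → X ∈ S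

/-- The thick subcategory generated by a class of objects. -/
def ThickSub (A : Set T) : Set T := ⋂₀ {S | IsThick T S ∧ A ⊆ S}

/-- `T` is compactly generated: it is generated, as a localizing subcategory,
by a set of compact objects. -/
def CompactlyGen : Prop :=
  ∃ (ι : Type v) (g : ι → T), (∀ i, IsCompactObj T (g i)) ∧ Loc T (Set.range g) = Set.univ

end CatDefs

section Action

variable {R : Type u} [Ring R] (𝒜 : ℤ → AddSubgroup R) [GradedRing 𝒜]
variable (T : Type u') [Category.{v} T] [HasZeroObject T] [Preadditive T] [HasShift T ℤ]
  [∀ n : ℤ, (CategoryTheory.shiftFunctor T n).Additive] [Pretriangulated T]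
  [HasCoproducts.{v} T]

/-- An action of the graded ring `R` on the triangulated category `T`, i.e. a homomorphism of
graded rings from `R` to the graded center of `T`: each homogeneous `a ∈ R` of degree `i`
determines a natural transformation `Id → Σⁱ` commuting with the shift up to the sign
`(-1)^i`. -/
structure CenterAction where
  act : ∀ (i : ℤ) (a : R), a ∈ 𝒜 i → ∀ X : T, X ⟶ X⟦i⟧
  act_add : ∀ (i : ℤ) (a b : R) (ha : a ∈ 𝒜 i) (hb : b ∈ 𝒜 i) (X : T),
    act i (a + b) (add_mem ha hb) X = act i a ha X + act i b hb X
  act_one : ∀ X : T, act 0 1 (SetLike.one_mem_graded 𝒜) X = (shiftFunctorZero T ℤ).inv.app X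
  act_mul : ∀ (i j : ℤ) (a b : R) (ha : a ∈ 𝒜 i) (hb : b ∈ 𝒜 j) (X : T),
    act (i + j) (a * b) (SetLike.mul_mem_graded ha hb) X
      = act j b hb X ≫ act i a ha (X⟦j⟧) ≫ (shiftFunctorAdd' T j i (i + j) (by ring)).inv.app X
  act_natural : ∀ (i : ℤ) (a : R) (ha : a ∈ 𝒜 i) {X Y : T} (f : X ⟶ Y),
    f ≫ act i a ha Y = act i a ha X ≫ f⟦i⟧'
  act_shift : ∀ (i : ℤ) (a : R) (ha : a ∈ 𝒜 i) (X : T) (n : ℤ),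
    act i a ha (X⟦n⟧)
      = ((-1 : ℤ) ^ (i * n).natAbs) • ((act i a ha X)⟦n⟧' ≫ (shiftComm X i n).hom)

variable {𝒜 T}

/-- The action of a homogeneous element of `R` on the graded abelian group
`Hom*(X, Y) = ⊕ₙ Hom(X, Y⟦n⟧)`. -/
def CenterAction.hsmul (A : CenterAction 𝒜 T) {i : ℤ} {a : R} (ha : a ∈ 𝒜 i) {X Y : T} {n : ℤ}
    (f : X ⟶ Y⟦n⟧) : X ⟶ Y⟦n + i⟧ :=
  f ≫ A.act i a ha (Y⟦n⟧) ≫ (shiftFunctorAdd' T n i (n + i) rfl).inv.app Y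

/-- The homogeneous localization of the graded `R`-module `Hom*(X, Y)` at the homogeneous
prime `p` vanishes: every element is annihilated by some homogeneous `s ∉ p`. -/
def LocVanishes (A : CenterAction 𝒜 T) (p : SpecR 𝒜) (X Y : T) : Prop :=
  ∀ (n : ℤ) (f : X ⟶ Y⟦n⟧), ∃ (i : ℤ) (s : R) (hs : s ∈ 𝒜 i),
    s ∉ p.1.toIdeal ∧ A.hsmul hs f = 0

variable (T) in
/-- The subcategory `T_V` of `V`-torsion objects, for `V ⊆ Spec R` specialization closed. -/
def TVset (A : CenterAction 𝒜 T) (V : Set (SpecR 𝒜)) : Set T :=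
  {X | ∀ C : T, IsCompactObj T C → ∀ p : SpecR 𝒜, p ∉ V → LocVanishes A p C X}

/-- The local cohomology and localization functors `Γ_V`, `L_V` attached to the `R`-action on
`T`: for each specialization closed `V ⊆ Spec R`, `L_V` is the (essentially unique) localization
functor with `Ker L_V = T_V`, and `Γ_V` is defined by the exact localization triangle
`Γ_V X → X → L_V X → `. -/
structure BIKData (A : CenterAction 𝒜 T) where
  Γ : Set (SpecR 𝒜) → T ⥤ T
  Lf : Set (SpecR 𝒜) → T ⥤ T
  γ : ∀ V : Set (SpecR 𝒜), Γ V ⟶ 𝟭 T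
  η : ∀ V : Set (SpecR 𝒜), 𝟭 T ⟶ Lf V
  δ : ∀ (V : Set (SpecR 𝒜)) (X : T), (Lf V).obj X ⟶ ((Γ V).obj X)⟦(1 : ℤ)⟧
  tri : ∀ V : Set (SpecR 𝒜), SpecClosed V → ∀ X : T,
    Triangle.mk ((γ V).app X) ((η V).app X) (δ V X) ∈ distTriang T
  Lη_iso : ∀ V : Set (SpecR 𝒜), SpecClosed V → ∀ X : T,
    IsIso ((Lf V).map ((η V).app X))
  Lη_eq : ∀ V : Set (SpecR 𝒜), SpecClosed V → ∀ X : T,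
    (Lf V).map ((η V).app X) = (η V).app ((Lf V).obj X)
  kerL : ∀ V : Set (SpecR 𝒜), SpecClosed V → ∀ X : T,
    Limits.IsZero ((Lf V).obj X) ↔ X ∈ TVset T A V

namespace BIKData

variable {A : CenterAction 𝒜 T} (B : BIKData A)

/-- `X_p = L_{Z(p)} X`. -/
def locP (p : SpecR 𝒜) (X : T) : T := (B.Lf (Zset p)).obj X

/-- `Γ_p = Γ_{V(p)} ∘ L_{Z(p)}`. -/
def ΓP (p : SpecR 𝒜) : T ⥤ T := B.Lf (Zset p) ⋙ B.Γ (Vp p)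

/-- `supp_R X = { p ∈ Spec R | Γ_p X ≠ 0 }`. -/
def suppObj (X : T) : Set (SpecR 𝒜) := {p | ¬ Limits.IsZero ((B.ΓP p).obj X)}

/-- `supp_R T = ⋃_X supp_R X`. -/
def suppT : Set (SpecR 𝒜) := {p | ∃ X : T, p ∈ B.suppObj X}

/-- The support of a class of objects. -/
def suppSet (S : Set T) : Set (SpecR 𝒜) := ⋃ X ∈ S, B.suppObj X

/-- `supp_R⁻¹ U`, the class of objects supported in `U`. -/
def invSupp (U : Set (SpecR 𝒜)) : Set T := {X | B.suppObj X ⊆ U}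

/-- `Γ_p T`, the essential image of `Γ_p`. -/
def ΓPImage (p : SpecR 𝒜) : Set T := {X | ∃ Y : T, Nonempty (X ≅ (B.ΓP p).obj Y)}

/-- The local-global principle: each object is built from its local cohomology objects. -/
def LocalGlobal : Prop :=
  ∀ X : T, Loc T {X} = Loc T {Y | ∃ p : SpecR 𝒜, Y = (B.ΓP p).obj X}

end BIKData

/-- A localizing subcategory is minimal if it is nonzero and has no proper nonzero localizing
subcategories. -/
def IsMinimalLoc (S : Set T) : Prop :=
  IsLocalizing T S ∧ (∃ X ∈ S, ¬ Limits.IsZero X) ∧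
    ∀ S' : Set T, IsLocalizing T S' → S' ⊆ S →
      (∀ X ∈ S', Limits.IsZero X) ∨ S' = S

/-- `T` is stratified by the `R`-action: the local-global principle holds and each `Γ_p T`
is either zero or a minimal localizing subcategory. -/
def Stratified {A : CenterAction 𝒜 T} (B : BIKData A) : Prop :=
  B.LocalGlobal ∧
    ∀ p : SpecR 𝒜, (∀ X ∈ B.ΓPImage p, Limits.IsZero X) ∨ IsMinimalLoc (B.ΓPImage p)

/-- A graded `R`-submodule of `Hom*(X,Y)`. -/
structure HomSub (A : CenterAction 𝒜 T) (X Y : T) where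
  car : ∀ n : ℤ, AddSubgroup (X ⟶ Y⟦n⟧)
  hsmul_mem : ∀ (i : ℤ) (a : R) (ha : a ∈ 𝒜 i) (n : ℤ) (f : X ⟶ Y⟦n⟧),
    f ∈ car n → A.hsmul ha f ∈ car (n + i)

/-- The graded `R`-module `Hom*(X,Y)` is finitely generated. -/
def FGHom (A : CenterAction 𝒜 T) (X Y : T) : Prop :=
  ∃ F : Finset ((n : ℤ) × (X ⟶ Y⟦n⟧)),
    ∀ S : HomSub A X Y, (∀ g ∈ F, g.2 ∈ S.car g.1) → ∀ (n : ℤ) (f : X ⟶ Y⟦n⟧), f ∈ S.car n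

/-- The `R`-linear category `T` is noetherian: `End*(C)` is a finitely generated `R`-module
for each compact object `C`. -/
def NoetherianT (A : CenterAction 𝒜 T) : Prop :=
  ∀ C : T, IsCompactObj T C → FGHom A C C

end Action

section Extra

variable {R : Type u} [Ring R] {𝒜 : ℤ → AddSubgroup R} [GradedRing 𝒜]
variable {T : Type u'} [Category.{v} T] [HasZeroObject T] [Preadditive T] [HasShift T ℤ]
  [∀ n : ℤ, (CategoryTheory.shiftFunctor T n).Additive] [Pretriangulated T]
  [HasCoproducts.{v} T]

/-- A subset of `Spec R` closed under generalization. -/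
def GenClosed (U : Set (SpecR 𝒜)) : Prop :=
  ∀ p q : SpecR 𝒜, q ∈ U → p.1.toIdeal ≤ q.1.toIdeal → p ∈ U

/-- `Supp_R Hom*(X,Y) = { p | Hom*(X,Y)_p ≠ 0 }`, the big support of the graded `R`-module
`Hom*(X,Y)`. -/
def bigSuppHom (A : CenterAction 𝒜 T) (X Y : T) : Set (SpecR 𝒜) :=
  {p | ¬ LocVanishes A p X Y}

/-- `Supp_R X = ⋃_{C compact} Supp_R Hom*(C,X)`, the big support of an object. -/
def bigSuppObj (A : CenterAction 𝒜 T) (X : T) : Set (SpecR 𝒜) :=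
  {p | ∃ C : T, IsCompactObj T C ∧ ¬ LocVanishes A p C X}

/-- The graded `R`-module `Hom*(X,Y)` is `p`-local: every homogeneous element outside of `p`
acts invertibly on it. -/
def PLocalHom (A : CenterAction 𝒜 T) (p : SpecR 𝒜) (X Y : T) : Prop :=
  ∀ (i : ℤ) (s : R) (hs : s ∈ 𝒜 i), s ∉ p.1.toIdeal →
    ∀ n : ℤ, Function.Bijective fun f : X ⟶ Y⟦n⟧ => A.hsmul hs f

/-- `K` is a Koszul object `X ⫽ a` of the homogeneous element `a` of degree `i` on `X`,
i.e. there is an exact triangle `X → Σ^i X → K → `, the first map being given by the action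
of `a`. -/
def IsKoszul (A : CenterAction 𝒜 T) {i : ℤ} (a : R) (ha : a ∈ 𝒜 i) (X K : T) : Prop :=
  ∃ (w : X⟦i⟧ ⟶ K) (d : K ⟶ X⟦(1 : ℤ)⟧),
    Triangle.mk (A.act i a ha X) w d ∈ distTriang T

/-- Iterated Koszul object on a finite sequence of homogeneous elements. -/
inductive IsKoszulSeq (A : CenterAction 𝒜 T) :
    T → List ((i : ℤ) × {a : R // a ∈ 𝒜 i}) → T → Prop
  | nil (X : T) : IsKoszulSeq A X [] X
  | cons (X Y K : T) (i : ℤ) (a : {a : R // a ∈ 𝒜 i})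
      (l : List ((i : ℤ) × {a : R // a ∈ 𝒜 i})) :
      IsKoszulSeq A X l Y → IsKoszul A a.1 a.2 Y K → IsKoszulSeq A X (⟨i, a⟩ :: l) K

/-- `K` is a Koszul object `X ⫽ 𝔞` of the homogeneous ideal `𝔞` on `X`, obtained by iterating
the Koszul construction on some finite sequence of homogeneous generators of `𝔞`. -/
def IsKoszulIdeal (A : CenterAction 𝒜 T) (𝔞 : HomogeneousIdeal 𝒜) (X K : T) : Prop :=
  ∃ l : List ((i : ℤ) × {a : R // a ∈ 𝒜 i}),
    Ideal.span {x : R | ∃ s ∈ l, (s.2 : R) = x} = 𝔞.toIdeal ∧ IsKoszulSeq A X l K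

end Extra

section Hocolim

variable {T : Type u'} [Category.{v} T] [Preadditive T] [HasCoproductsOfShape ℕ T]

/-- The map `⊕ₙ Xₙ → ⊕ₙ Xₙ` given by `id - fₙ`, whose cone is the homotopy colimit. -/
noncomputable def hoColimMap {Xs : ℕ → T} (fs : ∀ n, Xs n ⟶ Xs (n + 1)) : (∐ Xs) ⟶ (∐ Xs) :=
  Sigma.desc fun n => Sigma.ι Xs n - fs n ≫ Sigma.ι Xs (n + 1)

variable [HasZeroObject T] [HasShift T ℤ]
  [∀ n : ℤ, (CategoryTheory.shiftFunctor T n).Additive] [Pretriangulated T]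

/-- A homotopy colimit of the sequence `X₀ → X₁ → X₂ → ⋯`, defined by an exact triangle
`⊕ Xₙ → ⊕ Xₙ → hocolim Xₙ → `. -/
structure HocolimData (Xs : ℕ → T) (fs : ∀ n, Xs n ⟶ Xs (n + 1)) where
  pt : T
  ι : (∐ Xs) ⟶ pt
  d : pt ⟶ (∐ Xs)⟦(1 : ℤ)⟧
  tri : Triangle.mk (hoColimMap fs) ι d ∈ distTriang T

end Hocolim

end BIK

set_option linter.unusedSectionVars false

namespace BIK

section Compact

variable {T : Type u'} [Category.{v} T] [HasZeroObject T] [Preadditive T] [HasShift T ℤ]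
  [∀ n : ℤ, (CategoryTheory.shiftFunctor T n).Additive] [Pretriangulated T]
  [HasCoproducts.{v} T]

open Classical in
/-- The idempotent of a coproduct attached to a finite set of indices. -/
noncomputable def eproj {J : Type v} (f : J → T) (s : Finset J) : (∐ f) ⟶ (∐ f) :=
  Sigma.desc fun j => if j ∈ s then Sigma.ι f j else 0

lemma ι_eproj_mem {J : Type v} (f : J → T) (s : Finset J) (j : J) (h : j ∈ s) :
    Sigma.ι f j ≫ eproj f s = Sigma.ι f j := by
  simp [eproj, h]

lemma ι_eproj_not_mem {J : Type v} (f : J → T) (s : Finset J) (j : J) (h : j ∉ s) :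
    Sigma.ι f j ≫ eproj f s = 0 := by
  simp [eproj, h]

lemma eproj_mono {J : Type v} (f : J → T) {s t : Finset J} (h : s ⊆ t) :
    eproj f s ≫ eproj f t = eproj f s := by
  apply Sigma.hom_ext
  intro j
  by_cases hj : j ∈ s
  · rw [← Category.assoc, ι_eproj_mem f s j hj, ι_eproj_mem f t j (h hj)]
  · rw [← Category.assoc, ι_eproj_not_mem f s j hj, zero_comp]

open Classical in
lemma eproj_eq_sum {J : Type v} (f : J → T) (s : Finset J) :
    eproj f s = ∑ j ∈ s, Sigma.π f j ≫ Sigma.ι f j := by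
  apply Sigma.hom_ext
  intro j
  rw [Preadditive.comp_sum]
  by_cases hj : j ∈ s
  · rw [ι_eproj_mem f s j hj, Finset.sum_eq_single_of_mem j hj]
    · rw [Sigma.ι_π_eq_id_assoc]
    · intro b _ hb
      rw [← Category.assoc, Sigma.ι_π_of_ne f (Ne.symm hb), zero_comp]
  · rw [ι_eproj_not_mem f s j hj]
    symm
    apply Finset.sum_eq_zero
    intro b hb
    rw [← Category.assoc, Sigma.ι_π_of_ne f (fun h : j = b => hj (h ▸ hb)), zero_comp]

lemma sigmaHom_of (C : T) {J : Type v} [DecidableEq J] (f : J → T) (j : J) (g : C ⟶ f j) :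
    sigmaHom T C f (DirectSum.of (fun j => (C ⟶ f j)) j g) = g ≫ Sigma.ι f j := by
  unfold sigmaHom
  have : (Classical.decEq J) = (inferInstance : DecidableEq J) := Subsingleton.elim _ _
  rw [this]
  erw [DirectSum.toAddMonoid_of]
  rfl

open Classical in
lemma sigmaHom_π (C : T) {J : Type v} (f : J → T) (x : DirectSum J fun j => (C ⟶ f j)) (j : J) :
    sigmaHom T C f x ≫ Sigma.π f j = x j := by
  induction x using DirectSum.induction_on with
  | zero => simp
  | of i g =>
    rw [sigmaHom_of, Category.assoc]
    by_cases h : i = j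
    · subst h
      rw [Sigma.ι_π_eq_id, Category.comp_id, DirectSum.of_eq_same]
    · rw [Sigma.ι_π_of_ne f h, comp_zero, DirectSum.of_eq_of_ne _ _ _ (Ne.symm h)]
  | add a b ha hb => rw [map_add, Preadditive.add_comp, ha, hb, DirectSum.add_apply]

lemma sigmaHom_injective (C : T) {J : Type v} (f : J → T) :
    Function.Injective (sigmaHom T C f) := by
  classical
  intro x y h
  ext j
  rw [← sigmaHom_π, ← sigmaHom_π, h]

lemma sigmaHom_eproj (C : T) {J : Type v} (f : J → T) (x : DirectSum J fun j => (C ⟶ f j)) :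
    ∃ s : Finset J, sigmaHom T C f x ≫ eproj f s = sigmaHom T C f x := by
  classical
  induction x using DirectSum.induction_on with
  | zero => exact ⟨∅, by simp⟩
  | of i g =>
    refine ⟨{i}, ?_⟩
    rw [sigmaHom_of, Category.assoc, ι_eproj_mem f _ i (by simp)]
  | add a b ha hb =>
    obtain ⟨s, hs⟩ := ha
    obtain ⟨t, ht⟩ := hb
    refine ⟨s ∪ t, ?_⟩
    rw [map_add, Preadditive.add_comp]
    conv_lhs => rw [← hs, ← ht]
    rw [Category.assoc, Category.assoc, eproj_mono f Finset.subset_union_left,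
      eproj_mono f Finset.subset_union_right, hs, ht]

lemma compact_iff (C : T) : IsCompactObj T C ↔
    ∀ (J : Type v) (f : J → T) (g : C ⟶ ∐ f), ∃ s : Finset J, g ≫ eproj f s = g := by
  classical
  constructor
  · intro h J f g
    obtain ⟨x, rfl⟩ := (h J f).2 g
    exact sigmaHom_eproj C f x
  · intro h J f
    refine ⟨sigmaHom_injective C f, fun g => ?_⟩
    obtain ⟨s, hs⟩ := h J f g
    refine ⟨∑ j ∈ s, DirectSum.of (fun j => (C ⟶ f j)) j (g ≫ Sigma.π f j), ?_⟩
    rw [map_sum, ← hs, eproj_eq_sum, Preadditive.comp_sum]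
    refine Finset.sum_congr rfl fun j hj => ?_
    rw [sigmaHom_of, Category.assoc, ← Preadditive.comp_sum, ← eproj_eq_sum, hs]

/-- Closure of the class of compact objects under cones. -/
lemma compact_cone (Tr : Triangle T) (hTr : Tr ∈ distTriang T)
    (h1 : IsCompactObj T (Tr.obj₁⟦(1 : ℤ)⟧)) (h2 : IsCompactObj T Tr.obj₂) :
    IsCompactObj T Tr.obj₃ := by
  classical
  rw [compact_iff] at *
  intro J f g
  obtain ⟨s, hs⟩ := h2 J f (Tr.mor₂ ≫ g)
  obtain ⟨k, hk⟩ := Triangle.yoneda_exact₃ Tr hTr (g - g ≫ eproj f s) (by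
    rw [Preadditive.comp_sub, sub_eq_zero, ← Category.assoc, hs])
  obtain ⟨t, ht⟩ := h1 J f k
  have h3 : (g - g ≫ eproj f s) ≫ eproj f t = g - g ≫ eproj f s := by
    rw [hk, Category.assoc, ht]
  refine ⟨s ∪ t, ?_⟩
  have h4 : g = (g - g ≫ eproj f s) ≫ eproj f t + g ≫ eproj f s := by rw [h3]; abel
  conv_lhs => rw [h4]
  rw [Preadditive.add_comp, Category.assoc, Category.assoc, eproj_mono f Finset.subset_union_left,
      eproj_mono f Finset.subset_union_right, ← h4]

lemma compact_retract {X Y : T} (h : IsCompactObj T Y) (i : X ⟶ Y) (p : Y ⟶ X)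
    (hip : i ≫ p = 𝟙 X) : IsCompactObj T X := by
  rw [compact_iff] at *
  intro J f g
  obtain ⟨s, hs⟩ := h J f (p ≫ g)
  refine ⟨s, ?_⟩
  have : g = i ≫ p ≫ g := by rw [← Category.assoc, hip, Category.id_comp]
  rw [this, Category.assoc, hs]

lemma compact_iso {X Y : T} (e : X ≅ Y) (h : IsCompactObj T X) : IsCompactObj T Y :=
  compact_retract h e.inv e.hom e.inv_hom_id

lemma compact_zero {X : T} (h : IsZero X) : IsCompactObj T X := by
  rw [compact_iff]
  intro J f g
  exact ⟨∅, h.eq_of_src _ _⟩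

lemma compact_shift {X : T} (h : IsCompactObj T X) (n : ℤ) : IsCompactObj T (X⟦n⟧) := by
  rw [compact_iff] at *
  intro J f g
  let F := shiftFunctor T (-n)
  let φ : (∐ fun j => F.obj (f j)) ⟶ F.obj (∐ f) := sigmaComparison F f
  have hφ : IsIso φ := inferInstance
  let e : X ≅ (X⟦n⟧)⟦-n⟧ := (shiftShiftNeg X n).symm
  obtain ⟨s, hs⟩ := h J _ (e.hom ≫ F.map g ≫ inv φ)
  refine ⟨s, ?_⟩
  have h1 : eproj (fun j => F.obj (f j)) s ≫ φ = φ ≫ F.map (eproj f s) := by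
    apply Sigma.hom_ext
    intro j
    by_cases hj : j ∈ s
    · rw [← Category.assoc, ι_eproj_mem _ s j hj]
      simp only [φ, ι_comp_sigmaComparison, ι_comp_sigmaComparison_assoc]
      rw [← F.map_comp, ι_eproj_mem _ s j hj]
    · rw [← Category.assoc, ι_eproj_not_mem _ s j hj]
      simp only [φ, ι_comp_sigmaComparison_assoc]
      rw [← F.map_comp, ι_eproj_not_mem _ s j hj, F.map_zero, zero_comp]
  have h2 : e.hom ≫ F.map g ≫ F.map (eproj f s) = e.hom ≫ F.map g := by
    have h3 := congrArg (· ≫ φ) hs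
    simp only [Category.assoc, h1, IsIso.inv_hom_id, Category.comp_id,
      IsIso.inv_hom_id_assoc] at h3
    exact h3
  rw [cancel_epi, ← F.map_comp] at h2
  exact F.map_injective h2

end Compact

end BIK

namespace BIK

section Act

variable {R : Type u} [Ring R] {𝒜 : ℤ → AddSubgroup R} [GradedRing 𝒜]
variable {T : Type u'} [Category.{v} T] [HasZeroObject T] [Preadditive T] [HasShift T ℤ]
  [∀ n : ℤ, (CategoryTheory.shiftFunctor T n).Additive] [Pretriangulated T]
  [HasCoproducts.{v} T] (A : CenterAction 𝒜 T)

lemma sign_smul_eq_zero {M : Type*} [AddCommGroup M] (k : ℕ) (x : M)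
    (h : ((-1 : ℤ) ^ k) • x = 0) : x = 0 := by
  rcases neg_one_pow_eq_or ℤ k with h1 | h1 <;> rw [h1] at h <;> simpa using h

lemma act_shift_eq_zero_iff {i : ℤ} {a : R} (ha : a ∈ 𝒜 i) {X Z : T} (g : X ⟶ Z) (n : ℤ) :
    g⟦n⟧' ≫ A.act i a ha (Z⟦n⟧) = 0 ↔ g ≫ A.act i a ha Z = 0 := by
  rw [A.act_shift, Preadditive.comp_zsmul]
  constructor
  · intro h
    have h1 := sign_smul_eq_zero _ _ h
    rw [← Category.assoc, ← Functor.map_comp] at h1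
    have h2 := (cancel_mono (shiftComm Z i n).hom).1 (h1.trans zero_comp.symm)
    exact (shiftFunctor T n).map_injective (h2.trans ((shiftFunctor T n).map_zero _ _).symm)
  · intro h
    rw [← Category.assoc, ← Functor.map_comp, h, Functor.map_zero, zero_comp, smul_zero]

lemma comp_act_mul_right {i j : ℤ} {a b : R} (ha : a ∈ 𝒜 i) (hb : b ∈ 𝒜 j) {X Z : T} (g : X ⟶ Z)
    (h : g ≫ A.act j b hb Z = 0) :
    g ≫ A.act (i + j) (a * b) (SetLike.mul_mem_graded ha hb) Z = 0 := by
  rw [A.act_mul _ _ _ _ ha hb, ← Category.assoc, h, zero_comp]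

lemma comp_act_mul_left {i j : ℤ} {a b : R} (ha : a ∈ 𝒜 i) (hb : b ∈ 𝒜 j) {X Z : T} (g : X ⟶ Z)
    (h : g ≫ A.act i a ha Z = 0) :
    g ≫ A.act (i + j) (a * b) (SetLike.mul_mem_graded ha hb) Z = 0 := by
  rw [A.act_mul _ _ _ _ ha hb]
  have h1 := A.act_natural i a ha (A.act j b hb Z)
  rw [← Category.assoc (A.act j b hb Z), h1, Category.assoc, ← Category.assoc, h, zero_comp]

/-- The morphism `g` becomes zero after localization at `p`. -/
def Null (p : SpecR 𝒜) {X Z : T} (g : X ⟶ Z) : Prop :=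
  ∃ (i : ℤ) (s : R) (hs : s ∈ 𝒜 i), s ∉ p.1.toIdeal ∧ g ≫ A.act i s hs Z = 0

lemma mul_not_mem (p : SpecR 𝒜) {i j : ℤ} {s t : R} (hs : s ∈ 𝒜 i) (ht : t ∈ 𝒜 j)
    (h1 : s ∉ p.1.toIdeal) (h2 : t ∉ p.1.toIdeal) : s * t ∉ p.1.toIdeal :=
  fun h => (p.2.mem_or_mem hs ht h).elim h1 h2

lemma one_not_mem (p : SpecR 𝒜) : (1 : R) ∉ p.1.toIdeal :=
  fun h => p.2.ne_top ((Ideal.eq_top_iff_one _).2 h)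

variable {A}

lemma Null.zero (p : SpecR 𝒜) {X Z : T} : Null A p (0 : X ⟶ Z) :=
  ⟨0, 1, SetLike.one_mem_graded 𝒜, one_not_mem p, zero_comp⟩

lemma Null.comp_left {p : SpecR 𝒜} {X Y Z : T} {g : Y ⟶ Z} (h : Null A p g) (f : X ⟶ Y) :
    Null A p (f ≫ g) := by
  obtain ⟨i, s, hs, hp, h⟩ := h
  exact ⟨i, s, hs, hp, by rw [Category.assoc, h, comp_zero]⟩

lemma Null.comp_right {p : SpecR 𝒜} {X Y Z : T} {f : X ⟶ Y} (h : Null A p f) (g : Y ⟶ Z) :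
    Null A p (f ≫ g) := by
  obtain ⟨i, s, hs, hp, h⟩ := h
  exact ⟨i, s, hs, hp, by
    rw [Category.assoc, A.act_natural, ← Category.assoc, h, zero_comp]⟩

lemma Null.add {p : SpecR 𝒜} {X Z : T} {f g : X ⟶ Z} (hf : Null A p f) (hg : Null A p g) :
    Null A p (f + g) := by
  obtain ⟨i, s, hs, hp, h⟩ := hf
  obtain ⟨j, t, ht, hq, h'⟩ := hg
  refine ⟨i + j, s * t, SetLike.mul_mem_graded hs ht, mul_not_mem p hs ht hp hq, ?_⟩
  rw [Preadditive.add_comp, comp_act_mul_left A hs ht f h, comp_act_mul_right A hs ht g h',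
    add_zero]

lemma Null.sum {p : SpecR 𝒜} {X Z : T} {ι : Type*} (s : Finset ι) (f : ι → (X ⟶ Z))
    (h : ∀ j ∈ s, Null A p (f j)) : Null A p (∑ j ∈ s, f j) := by
  classical
  induction s using Finset.induction_on with
  | empty => simpa using Null.zero p
  | insert a s ha ih =>
    rw [Finset.sum_insert ha]
    exact (h a (by simp)).add (ih fun j hj => h j (by simp [hj]))

lemma null_shift_iff {p : SpecR 𝒜} {X Z : T} (g : X ⟶ Z) (n : ℤ) :
    Null A p (g⟦n⟧') ↔ Null A p g := by
  constructor
  · rintro ⟨i, s, hs, hp, h⟩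
    exact ⟨i, s, hs, hp, (act_shift_eq_zero_iff A hs g n).1 h⟩
  · rintro ⟨i, s, hs, hp, h⟩
    exact ⟨i, s, hs, hp, (act_shift_eq_zero_iff A hs g n).2 h⟩

/-- If `f` becomes null after applying one more element outside of `p`, it is null. -/
lemma Null.of_comp_act {p : SpecR 𝒜} {X Z : T} {f : X ⟶ Z} {i : ℤ} {s : R} (hs : s ∈ 𝒜 i)
    (hp : s ∉ p.1.toIdeal) (h : Null A p (f ≫ A.act i s hs Z)) : Null A p f := by
  obtain ⟨j, t, ht, hq, h⟩ := h
  refine ⟨j + i, t * s, SetLike.mul_mem_graded ht hs, mul_not_mem p ht hs hq hp, ?_⟩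
  rw [A.act_mul _ _ _ _ ht hs, ← Category.assoc, ← Category.assoc, h, zero_comp]

variable (A)

/-- `Hom*(K, Z)_p = 0`. -/
def Van (p : SpecR 𝒜) (K Z : T) : Prop := ∀ (m : ℤ) (g : K⟦m⟧ ⟶ Z), Null A p g

lemma hsmul_eq_zero_iff {i : ℤ} {a : R} (ha : a ∈ 𝒜 i) {X Y : T} {n : ℤ} (f : X ⟶ Y⟦n⟧) :
    A.hsmul ha f = 0 ↔ f ≫ A.act i a ha (Y⟦n⟧) = 0 := by
  unfold CenterAction.hsmul
  rw [← Category.assoc]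
  constructor
  · intro h
    exact (cancel_mono ((shiftFunctorAdd' T n i (n + i) rfl).inv.app Y)).1
      (h.trans zero_comp.symm)
  · intro h
    rw [h, zero_comp]

lemma locVanishes_iff (p : SpecR 𝒜) (K Z : T) : LocVanishes A p K Z ↔ Van A p K Z := by
  have h0 : LocVanishes A p K Z ↔ ∀ (n : ℤ) (f : K ⟶ Z⟦n⟧), Null A p f := by
    unfold LocVanishes Null
    simp only [hsmul_eq_zero_iff]
  rw [h0]
  constructor
  · intro h m g
    rw [← null_shift_iff g (-m)]
    have h1 := (h (-m) ((shiftShiftNeg K m).inv ≫ g⟦-m⟧')).comp_left (shiftShiftNeg K m).hom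
    rwa [Iso.hom_inv_id_assoc] at h1
  · intro h n f
    rw [← null_shift_iff f (-n)]
    have h1 := (h (-n) (f⟦-n⟧' ≫ (shiftShiftNeg Z n).hom)).comp_right (shiftShiftNeg Z n).inv
    rwa [Category.assoc, Iso.hom_inv_id, Category.comp_id] at h1

/-- The identity of `X` becomes zero after localization at `p`. -/
def IdNull (p : SpecR 𝒜) (X : T) : Prop := Null A p (𝟙 X)

variable {A}

lemma IdNull.iff {p : SpecR 𝒜} {X : T} : IdNull A p X ↔
    ∃ (i : ℤ) (s : R) (hs : s ∈ 𝒜 i), s ∉ p.1.toIdeal ∧ A.act i s hs X = 0 := by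
  simp only [IdNull, Null, Category.id_comp]

lemma IdNull.null_to {p : SpecR 𝒜} {X Z : T} (h : IdNull A p Z) (g : X ⟶ Z) : Null A p g := by
  have := Null.comp_left h g
  rwa [Category.comp_id] at this

lemma IdNull.null_from {p : SpecR 𝒜} {X Z : T} (h : IdNull A p X) (g : X ⟶ Z) : Null A p g := by
  have := Null.comp_right h g
  rwa [Category.id_comp] at this

lemma IdNull.shift {p : SpecR 𝒜} {X : T} (h : IdNull A p X) (n : ℤ) : IdNull A p (X⟦n⟧) := by
  have := (null_shift_iff (𝟙 X) n).2 h
  rwa [CategoryTheory.Functor.map_id] at this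

lemma IdNull.retract {p : SpecR 𝒜} {X Y : T} (h : IdNull A p Y) (i : X ⟶ Y) (r : Y ⟶ X)
    (hir : i ≫ r = 𝟙 X) : IdNull A p X := by
  unfold IdNull
  rw [← hir]
  exact (h.null_to i).comp_right r

lemma IdNull.of_isZero {p : SpecR 𝒜} {X : T} (h : IsZero X) : IdNull A p X := by
  unfold IdNull
  rw [h.eq_of_src (𝟙 X) 0]
  exact Null.zero p

lemma IdNull.mono {p q : SpecR 𝒜} (hqp : q.1.toIdeal ≤ p.1.toIdeal) {X : T} (h : IdNull A p X) :
    IdNull A q X := by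
  obtain ⟨i, s, hs, hp, h⟩ := h
  exact ⟨i, s, hs, fun h' => hp (hqp h'), h⟩

lemma exists_unshift {X Z : T} {i : ℤ} (F : X ⟶ Z⟦i⟧) :
    ∃ F' : X⟦-i⟧ ⟶ Z, F = (shiftNegShift X i).inv ≫ F'⟦i⟧' := by
  refine ⟨(shiftFunctor T i).preimage ((shiftNegShift X i).hom ≫ F), ?_⟩
  rw [Functor.map_preimage, Iso.inv_hom_id_assoc]

lemma shift_exact₃ (Tr : Triangle T) (hTr : Tr ∈ distTriang T) {X : T} (i : ℤ)
    (F : X ⟶ Tr.obj₃⟦i⟧) (h : F ≫ Tr.mor₃⟦i⟧' = 0) :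
    ∃ g : X ⟶ Tr.obj₂⟦i⟧, F = g ≫ Tr.mor₂⟦i⟧' := by
  obtain ⟨F', rfl⟩ := exists_unshift F
  rw [Category.assoc, ← Functor.map_comp] at h
  have h1 := (cancel_epi (shiftNegShift X i).inv).1 (h.trans comp_zero.symm)
  have h2 := (shiftFunctor T i).map_injective (h1.trans ((shiftFunctor T i).map_zero _ _).symm)
  obtain ⟨g, hg⟩ := Triangle.coyoneda_exact₃ Tr hTr F' h2
  exact ⟨(shiftNegShift X i).inv ≫ g⟦i⟧', by rw [hg, Functor.map_comp, Category.assoc]⟩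

lemma shift_exact₂ (Tr : Triangle T) (hTr : Tr ∈ distTriang T) {X : T} (i : ℤ)
    (F : X ⟶ Tr.obj₂⟦i⟧) (h : F ≫ Tr.mor₂⟦i⟧' = 0) :
    ∃ g : X ⟶ Tr.obj₁⟦i⟧, F = g ≫ Tr.mor₁⟦i⟧' := by
  obtain ⟨F', rfl⟩ := exists_unshift F
  rw [Category.assoc, ← Functor.map_comp] at h
  have h1 := (cancel_epi (shiftNegShift X i).inv).1 (h.trans comp_zero.symm)
  have h2 := (shiftFunctor T i).map_injective (h1.trans ((shiftFunctor T i).map_zero _ _).symm)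
  obtain ⟨g, hg⟩ := Triangle.coyoneda_exact₂ Tr hTr F' h2
  exact ⟨(shiftNegShift X i).inv ≫ g⟦i⟧', by rw [hg, Functor.map_comp, Category.assoc]⟩

lemma null_cone_aux {p : SpecR 𝒜} (Tr : Triangle T) (hTr : Tr ∈ distTriang T) {X : T}
    (f : X ⟶ Tr.obj₃) (h3 : Null A p (f ≫ Tr.mor₃))
    (h2 : ∀ (n : ℤ) (g : X ⟶ Tr.obj₂⟦n⟧), Null A p g) : Null A p f := by
  obtain ⟨i, s, hs, hp, h⟩ := h3
  apply Null.of_comp_act hs hp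
  rw [Category.assoc, A.act_natural, ← Category.assoc] at h
  obtain ⟨g, hg⟩ := shift_exact₃ Tr hTr i (f ≫ A.act i s hs Tr.obj₃) h
  rw [hg]
  exact (h2 i g).comp_right _

lemma Van.shift {p : SpecR 𝒜} {K Z : T} (hZ : Van A p K Z) (n : ℤ) : Van A p K (Z⟦n⟧) := by
  intro m g
  rw [← null_shift_iff g (-n)]
  have h1 := (hZ (m + -n) ((shiftFunctorAdd T m (-n)).hom.app K ≫ g⟦-n⟧' ≫
    (shiftShiftNeg Z n).hom)).comp_right (shiftShiftNeg Z n).inv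
  have h2 := h1.comp_left ((shiftFunctorAdd T m (-n)).inv.app K)
  rw [Category.assoc, Category.assoc, Iso.hom_inv_id, Category.comp_id] at h2
  rwa [Iso.inv_hom_id_app_assoc] at h2

lemma Van.cone {p : SpecR 𝒜} {K : T} (Tr : Triangle T) (hTr : Tr ∈ distTriang T)
    (h1 : Van A p K Tr.obj₁) (h2 : Van A p K Tr.obj₂) : Van A p K Tr.obj₃ := by
  intro m f
  exact null_cone_aux Tr hTr f ((h1.shift 1) m _) (fun n g => (h2.shift n) m g)

lemma IdNull.cone {p : SpecR 𝒜} (Tr : Triangle T) (hTr : Tr ∈ distTriang T)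
    (h1 : IdNull A p Tr.obj₁) (h2 : IdNull A p Tr.obj₂) : IdNull A p Tr.obj₃ :=
  null_cone_aux Tr hTr _ ((h1.shift 1).null_to _) (fun n g => (h2.shift n).null_to g)

/-- The objects `Z` with `Hom*(K, Z)_p = 0` form a localizing subcategory if `K` is compact. -/
lemma van_localizing (p : SpecR 𝒜) {K : T} (hK : IsCompactObj T K) :
    IsLocalizing T {Z | Van A p K Z} where
  zero_mem X hX m g := by
    rw [hX.eq_of_tgt g 0]; exact Null.zero p
  iso_mem {X Y} e hX m g := by
    have := (hX m (g ≫ e.inv)).comp_right e.hom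
    simpa using this
  shift_mem X hX n := Van.shift hX n
  ext_mem Tr hTr h1 h2 := Van.cone Tr hTr h1 h2
  coprod_mem J f hf m g := by
    classical
    obtain ⟨s, hs⟩ := (compact_iff _).1 (compact_shift hK m) J f g
    rw [← hs, eproj_eq_sum, Preadditive.comp_sum]
    apply Null.sum
    intro j _
    rw [← Category.assoc]
    exact (hf j m _).comp_right _

lemma mem_TVset {V : Set (SpecR 𝒜)} {X : T} :
    X ∈ TVset T A V ↔ ∀ C : T, IsCompactObj T C → ∀ p : SpecR 𝒜, p ∉ V → Van A p C X := by
  simp only [TVset, Set.mem_ofPred_eq, locVanishes_iff]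

lemma TVset_of_idNull {V : Set (SpecR 𝒜)} {X : T} (h : ∀ p ∉ V, IdNull A p X) :
    X ∈ TVset T A V := by
  rw [mem_TVset]
  intro C _ p hp m g
  exact (h p hp).null_to g

lemma TVset_shift {V : Set (SpecR 𝒜)} {X : T} (h : X ∈ TVset T A V) (n : ℤ) :
    X⟦n⟧ ∈ TVset T A V := by
  rw [mem_TVset] at *
  intro C hC p hp
  exact (h C hC p hp).shift n

lemma TVset_zero {V : Set (SpecR 𝒜)} {X : T} (h : IsZero X) : X ∈ TVset T A V :=
  TVset_of_idNull fun _ _ => IdNull.of_isZero h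

lemma idNull_of_TVset {V : Set (SpecR 𝒜)} {X : T} (hX : IsCompactObj T X)
    (h : X ∈ TVset T A V) (p : SpecR 𝒜) (hp : p ∉ V) : IdNull A p X := by
  rw [mem_TVset] at h
  have h1 := h X hX p hp 0 ((shiftFunctorZero T ℤ).hom.app X)
  have h2 := h1.comp_left ((shiftFunctorZero T ℤ).inv.app X)
  unfold IdNull
  simpa using h2

end Act

end BIK

namespace BIK

section Neeman

variable {T : Type u'} [Category.{v} T] [HasZeroObject T] [Preadditive T] [HasShift T ℤ]
  [∀ n : ℤ, (CategoryTheory.shiftFunctor T n).Additive] [Pretriangulated T]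
  [HasCoproducts.{v} T]

lemma loc_min {A S : Set T} (hS : IsLocalizing T S) (h : A ⊆ S) : Loc T A ⊆ S :=
  Set.sInter_subset_of_mem ⟨hS, h⟩

lemma subset_loc (A : Set T) : A ⊆ Loc T A := by
  intro X hX S hS
  exact hS.2 hX

lemma loc_localizing (A : Set T) : IsLocalizing T (Loc T A) where
  zero_mem X hX S hS := hS.1.zero_mem X hX
  iso_mem e hX S hS := hS.1.iso_mem e (hX S hS)
  shift_mem X hX n S hS := hS.1.shift_mem X (hX S hS) n
  ext_mem Tr hTr h1 h2 S hS := hS.1.ext_mem Tr hTr (h1 S hS) (h2 S hS)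
  coprod_mem J f hf S hS := hS.1.coprod_mem J f fun j => hf j S hS

lemma loc_mono {A A' : Set T} (h : A ⊆ A') : Loc T A ⊆ Loc T A' :=
  loc_min (loc_localizing A') (h.trans (subset_loc A'))

/-- A localizing subcategory generated by a class is the union of those generated by small
subsets. -/
lemma loc_small {S : Set T} {C : T} (hC : C ∈ Loc T S) :
    ∃ (ι : Type v) (g : ι → T), (∀ i, g i ∈ S) ∧ C ∈ Loc T (Set.range g) := by
  refine loc_min (S := {C | ∃ (ι : Type v) (g : ι → T), (∀ i, g i ∈ S) ∧
    C ∈ Loc T (Set.range g)}) ?_ ?_ hC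
  · constructor
    · intro X hX
      exact ⟨PEmpty, PEmpty.elim, fun i => i.elim, (loc_localizing _).zero_mem X hX⟩
    · rintro X Y e ⟨ι, g, hg, hX⟩
      exact ⟨ι, g, hg, (loc_localizing _).iso_mem e hX⟩
    · rintro X ⟨ι, g, hg, hX⟩ n
      exact ⟨ι, g, hg, (loc_localizing _).shift_mem X hX n⟩
    · rintro Tr hTr ⟨ι, g, hg, hX⟩ ⟨ι', g', hg', hX'⟩
      refine ⟨ι ⊕ ι', Sum.elim g g', ?_, (loc_localizing _).ext_mem Tr hTr ?_ ?_⟩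
      · rintro (i | i)
        · exact hg i
        · exact hg' i
      · exact loc_mono (by rintro _ ⟨i, rfl⟩; exact ⟨Sum.inl i, rfl⟩) hX
      · exact loc_mono (by rintro _ ⟨i, rfl⟩; exact ⟨Sum.inr i, rfl⟩) hX'
    · intro J f hf
      choose ι g hg hX using hf
      refine ⟨Σ j, ι j, fun x => g x.1 x.2, fun x => hg x.1 x.2,
        (loc_localizing _).coprod_mem J f fun j => ?_⟩
      exact loc_mono (by rintro _ ⟨i, rfl⟩; exact ⟨⟨j, i⟩, rfl⟩) (hX j)
  · intro X hX
    exact ⟨PUnit, fun _ => X, fun _ => hX, subset_loc _ ⟨PUnit.unit, rfl⟩⟩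

lemma thick_mid {S : Set T} (hS : IsThick T S) (Tr : Triangle T) (hTr : Tr ∈ distTriang T)
    (h1 : Tr.obj₁ ∈ S) (h3 : Tr.obj₃ ∈ S) : Tr.obj₂ ∈ S :=
  hS.ext_mem Tr.invRotate (inv_rot_of_distTriang Tr hTr) (hS.shift_mem _ h3 _) h1

lemma thick_biprod {S : Set T} (hS : IsThick T S) {X Y : T} (hX : X ∈ S) (hY : Y ∈ S)
    [HasBinaryBiproduct X Y] : (X ⊞ Y) ∈ S :=
  thick_mid hS _ (binaryBiproductTriangle_distinguished X Y) hX hY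

/-- The morphism factors through an object of `S`. -/
def Fact (S : Set T) {X Y : T} (k : X ⟶ Y) : Prop :=
  ∃ (D : T) (a : X ⟶ D) (b : D ⟶ Y), D ∈ S ∧ k = a ≫ b

lemma Fact.comp_left {S : Set T} {W X Y : T} {k : X ⟶ Y} (h : Fact S k) (l : W ⟶ X) :
    Fact S (l ≫ k) := by
  obtain ⟨D, a, b, hD, rfl⟩ := h
  exact ⟨D, l ≫ a, b, hD, by simp⟩

lemma Fact.comp_right {S : Set T} {W X Y : T} {k : X ⟶ Y} (h : Fact S k) (l : Y ⟶ W) :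
    Fact S (k ≫ l) := by
  obtain ⟨D, a, b, hD, rfl⟩ := h
  exact ⟨D, a, b ≫ l, hD, by simp⟩

lemma Fact.zero {S : Set T} (hS : IsThick T S) {X Y : T} : Fact S (0 : X ⟶ Y) := by
  obtain ⟨Z, hZ⟩ := HasZeroObject.zero (C := T)
  exact ⟨Z, 0, 0, hS.zero_mem _ hZ, by simp⟩

lemma Fact.add {S : Set T} (hS : IsThick T S) {X Y : T} {k l : X ⟶ Y} (hk : Fact S k)
    (hl : Fact S l) : Fact S (k + l) := by
  obtain ⟨D, a, b, hD, rfl⟩ := hk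
  obtain ⟨D', a', b', hD', rfl⟩ := hl
  have : HasBinaryBiproducts T := inferInstance
  exact ⟨D ⊞ D', biprod.lift a a', biprod.desc b b', thick_biprod hS hD hD', by simp⟩

lemma Fact.sum {S : Set T} (hS : IsThick T S) {X Y : T} {ι : Type*} (s : Finset ι)
    (k : ι → (X ⟶ Y)) (h : ∀ j ∈ s, Fact S (k j)) : Fact S (∑ j ∈ s, k j) := by
  classical
  induction s using Finset.induction_on with
  | empty => simpa using Fact.zero hS
  | insert a s ha ih =>
    rw [Finset.sum_insert ha]
    exact Fact.add hS (h a (by simp)) (ih fun j hj => h j (by simp [hj]))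

/-- One step of the construction of the Bousfield localization. -/
lemma exists_next {S : Set T} (hS : IsThick T S) {ι : Type v} (g : ι → T) (hg : ∀ i, g i ∈ S)
    (X : T) : ∃ (X' : T) (φ : X ⟶ X'),
      (∀ (i : ι) (m : ℤ) (h : (g i)⟦m⟧ ⟶ X), h ≫ φ = 0) ∧
      (∀ (Y : T) (_ : IsCompactObj T Y) (k : Y ⟶ X), k ≫ φ = 0 → Fact S k) := by
  classical
  let J : Type v := Σ (i : ι) (m : ℤ), ((g i)⟦m⟧ ⟶ X)
  let F : J → T := fun x => (g x.1)⟦x.2.1⟧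
  let ψ : (∐ F) ⟶ X := Sigma.desc fun x => x.2.2
  obtain ⟨X', φ, d, hT⟩ := distinguished_cocone_triangle ψ
  refine ⟨X', φ, ?_, ?_⟩
  · intro i m h
    have h1 : h = Sigma.ι F ⟨i, m, h⟩ ≫ ψ := by simp [ψ]
    have h2 : ψ ≫ φ = 0 := comp_distTriang_mor_zero₁₂ _ hT
    rw [h1, Category.assoc, h2, comp_zero]
  · intro Y hY k hk
    obtain ⟨k', hk'⟩ := Triangle.coyoneda_exact₂ _ hT k hk
    change k = k' ≫ ψ at hk'
    obtain ⟨s, hs⟩ := (compact_iff Y).1 hY J F k'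
    rw [hk', ← hs]
    apply Fact.comp_right
    apply Fact.comp_left
    rw [eproj_eq_sum]
    apply Fact.sum hS
    intro j _
    exact ⟨F j, _, _, hS.shift_mem _ (hg _) _, rfl⟩

lemma extend_first {F E G C : T} {α : F ⟶ E} {β : E ⟶ G} {δ : G ⟶ F⟦(1 : ℤ)⟧}
    (hE : Triangle.mk α β δ ∈ distTriang T) (h : F ⟶ C) (hh : δ ≫ h⟦(1 : ℤ)⟧' = 0) :
    ∃ j : E ⟶ C, h = α ≫ j := by
  obtain ⟨g, hg⟩ := Triangle.yoneda_exact₃ _ (rot_of_distTriang _ hE) (h⟦(1 : ℤ)⟧') hh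
  change E⟦(1 : ℤ)⟧ ⟶ C⟦(1 : ℤ)⟧ at g
  change h⟦(1 : ℤ)⟧' = (-α⟦(1 : ℤ)⟧') ≫ g at hg
  obtain ⟨j, rfl⟩ := (shiftFunctor T (1 : ℤ)).map_surjective g
  refine ⟨-j, (shiftFunctor T (1 : ℤ)).map_injective ?_⟩
  rw [hg, Functor.map_comp, Functor.map_neg, Preadditive.neg_comp, Preadditive.comp_neg]

/-- Finite compositions of morphisms with cone in `S`. -/
inductive ChainMap (S : Set T) : ∀ {A B : T}, (A ⟶ B) → Prop
  | id (A : T) : ChainMap S (𝟙 A)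
  | cons {A B D C : T} (f : A ⟶ B) (v : B ⟶ D) (d : D ⟶ A⟦(1 : ℤ)⟧)
      (hT : Triangle.mk f v d ∈ distTriang T) (hD : D ∈ S) (w : B ⟶ C) (hw : ChainMap S w) :
      ChainMap S (f ≫ w)

/-- If a finite composition of morphisms with cone in `S` factors through `S`, its target belongs
to `S`. (This avoids the octahedral property.) -/
lemma ChainMap.mem {S : Set T} (hS : IsThick T S) {B C : T} {g : B ⟶ C} (hg : ChainMap S g) :
    Fact S g → C ∈ S := by
  induction hg with
  | id A =>
    rintro ⟨D, a, b, hD, h⟩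
    exact hS.retract_mem _ _ hD a b h.symm
  | @cons B B₁ G C g₁ v d hT hG g' hg' ih =>
    rintro ⟨F, u, h, hF, hgu⟩
    apply ih
    obtain ⟨E, α, β, hE⟩ := distinguished_cocone_triangle₂ (d ≫ u⟦(1 : ℤ)⟧')
    have hES : E ∈ S := thick_mid hS _ hE hF hG
    obtain ⟨i, hi1, hi2⟩ := complete_distinguished_triangle_morphism₂ _ _ hT hE u (𝟙 G)
      (Category.id_comp _).symm
    change B₁ ⟶ E at i
    change g₁ ≫ i = u ≫ α at hi1
    change v ≫ 𝟙 G = i ≫ β at hi2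
    -- extend `h` to `E`
    have hjj : ∃ j : E ⟶ C, h = α ≫ j := by
      refine extend_first hE h ?_
      have hz : d ≫ g₁⟦(1 : ℤ)⟧' = 0 := comp_distTriang_mor_zero₃₁ _ hT
      rw [Category.assoc, ← Functor.map_comp, ← hgu, Functor.map_comp, ← Category.assoc, hz,
        zero_comp]
    obtain ⟨j, hj⟩ := hjj
    obtain ⟨x, hx⟩ := Triangle.yoneda_exact₂ _ hT (i ≫ j - g') (by
      change g₁ ≫ (i ≫ j - g') = 0
      rw [Preadditive.comp_sub, sub_eq_zero, ← Category.assoc, hi1, Category.assoc, ← hj, hgu])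
    change G ⟶ C at x
    change i ≫ j - g' = v ≫ x at hx
    refine ⟨E, i, j - β ≫ x, hES, ?_⟩
    have hi3 : i ≫ β = v := by rw [← hi2]; simp
    rw [Preadditive.comp_sub, ← Category.assoc i β x, hi3, ← hx]
    abel

lemma compact_fst (Tr : Triangle T) (hTr : Tr ∈ distTriang T)
    (h2 : IsCompactObj T Tr.obj₂) (h3 : IsCompactObj T Tr.obj₃) :
    IsCompactObj T Tr.obj₁ := by
  have h : IsCompactObj T (Tr.obj₁⟦(1 : ℤ)⟧) :=
    compact_cone Tr.rotate (rot_of_distTriang Tr hTr) (compact_shift h2 1) h3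
  exact compact_iso (shiftShiftNeg Tr.obj₁ (1 : ℤ)) (compact_shift h (-1))

/-- Objects right orthogonal to all shifts. -/
lemma orth_localizing (Y : T) :
    IsLocalizing T {X | ∀ (m : ℤ) (f : X ⟶ Y⟦m⟧), f = 0} := by
  have shift : ∀ X : T, (∀ (m : ℤ) (f : X ⟶ Y⟦m⟧), f = 0) → ∀ (n m : ℤ) (f : X⟦n⟧ ⟶ Y⟦m⟧),
      f = 0 := by
    intro X hX n m f
    have h1 := hX (m + -n) ((shiftShiftNeg X n).inv ≫ f⟦-n⟧' ≫
      (shiftFunctorAdd T m (-n)).inv.app Y)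
    have h2 := (cancel_epi _).1 (h1.trans comp_zero.symm)
    have h3 := (cancel_mono _).1 (h2.trans zero_comp.symm)
    exact (shiftFunctor T (-n)).map_injective (h3.trans ((shiftFunctor T (-n)).map_zero _ _).symm)
  constructor
  · intro X hX m f
    exact hX.eq_of_src _ _
  · intro X Z e hX m f
    have h1 := hX m (e.hom ≫ f)
    exact (cancel_epi e.hom).1 (h1.trans comp_zero.symm)
  · intro X hX n m f
    exact shift X hX n m f
  · intro Tr hTr h1 h2 m f
    obtain ⟨k, hk⟩ := Triangle.yoneda_exact₃ Tr hTr f (h2 m _)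
    rw [hk, shift _ h1 1 m k, comp_zero]
  · intro J f hf m g
    apply Sigma.hom_ext
    intro j
    rw [hf j m (Sigma.ι f j ≫ g), comp_zero]

/-- Neeman: a compact object in the localizing subcategory generated by a thick subcategory `S` of
compact objects belongs to `S`. -/
theorem neeman {S : Set T} (hS : IsThick T S) (hSc : ∀ X ∈ S, IsCompactObj T X) {C : T}
    (hC : IsCompactObj T C) (hCS : C ∈ Loc T S) : C ∈ S := by
  classical
  obtain ⟨ι, g, hg, hCg⟩ := loc_small hCS
  choose nx φ hφ1 hφ2 using fun X : T => exists_next hS g hg X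
  let Xs : ℕ → T := fun n => Nat.rec (motive := fun _ => T) C (fun _ X => nx X) n
  let fs : ∀ n, Xs n ⟶ Xs (n + 1) := fun n => φ (Xs n)
  let Φ : ∀ n, C ⟶ Xs n := fun n => Nat.rec (𝟙 C) (fun n k => k ≫ fs n) n
  let U : ULift.{v} ℕ → T := fun n => Xs n.down
  let inn : ∀ n : ℕ, Xs n ⟶ ∐ U := fun n => Sigma.ι U ⟨n⟩
  let pr : ∀ n : ℕ, (∐ U) ⟶ Xs n := fun n => Sigma.π U ⟨n⟩
  have inn_pr : ∀ n, inn n ≫ pr n = 𝟙 _ := fun n => Sigma.ι_π_eq_id U ⟨n⟩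
  have inn_pr_ne : ∀ m n : ℕ, m ≠ n → inn m ≫ pr n = 0 := fun m n h =>
    Sigma.ι_π_of_ne U (fun h' => h (congrArg ULift.down h'))
  let M : (∐ U) ⟶ ∐ U := Sigma.desc fun n => inn n.down - fs n.down ≫ inn (n.down + 1)
  have inn_M : ∀ n, inn n ≫ M = inn n - fs n ≫ inn (n + 1) := fun n => by
    simp [inn, M]
  have M_pr0 : M ≫ pr 0 = pr 0 := by
    apply Sigma.hom_ext
    rintro ⟨n⟩
    change inn n ≫ M ≫ pr 0 = inn n ≫ pr 0
    rw [← Category.assoc, inn_M, Preadditive.sub_comp, Category.assoc,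
      inn_pr_ne (n + 1) 0 (by omega), comp_zero, sub_zero]
  have M_prs : ∀ n, M ≫ pr (n + 1) = pr (n + 1) - pr n ≫ fs n := by
    intro n
    apply Sigma.hom_ext
    rintro ⟨m⟩
    change inn m ≫ M ≫ pr (n + 1) = inn m ≫ (pr (n + 1) - pr n ≫ fs n)
    rw [← Category.assoc, inn_M, Preadditive.sub_comp, Preadditive.comp_sub, Category.assoc,
      ← Category.assoc (inn m) (pr n)]
    by_cases h : m = n
    · subst h
      rw [inn_pr, inn_pr, Category.comp_id, Category.id_comp]
    · rw [inn_pr_ne m n h, inn_pr_ne (m + 1) (n + 1) (by omega), comp_zero, zero_comp]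
  obtain ⟨Y, c, d, hT⟩ := distinguished_cocone_triangle M
  have hMc : M ≫ c = 0 := comp_distTriang_mor_zero₁₂ _ hT
  have inn_c : ∀ n, inn n ≫ c = fs n ≫ inn (n + 1) ≫ c := by
    intro n
    have h1 : inn n ≫ M ≫ c = 0 := by rw [hMc, comp_zero]
    rw [← Category.assoc, inn_M, Preadditive.sub_comp, sub_eq_zero, Category.assoc] at h1
    exact h1
  have sumform : ∀ (D : T), IsCompactObj T D → ∀ (h : D ⟶ ∐ U), ∃ s : Finset (ULift.{v} ℕ),
      h = ∑ n ∈ s, (h ≫ pr n.down) ≫ inn n.down := by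
    intro D hD h
    obtain ⟨s, hs⟩ := (compact_iff D).1 hD _ U h
    refine ⟨s, ?_⟩
    conv_lhs => rw [← hs, eproj_eq_sum, Preadditive.comp_sum]
    refine Finset.sum_congr rfl fun n _ => ?_
    rw [Category.assoc]
    congr!
  -- the homotopy colimit is right orthogonal to the generators
  have key1 : ∀ (i : ι) (m : ℤ) (f : (g i)⟦m⟧ ⟶ Y), f = 0 := by
    intro i m f
    have hD : IsCompactObj T ((g i)⟦m⟧) := compact_shift (hSc _ (hg i)) m
    have hfd : f ≫ d = 0 := by
      obtain ⟨F, hF⟩ := exists_unshift (f ≫ d)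
      have hdM : d ≫ M⟦(1 : ℤ)⟧' = 0 := comp_distTriang_mor_zero₃₁ _ hT
      have h1 : (f ≫ d) ≫ M⟦(1 : ℤ)⟧' = 0 := by rw [Category.assoc, hdM, comp_zero]
      rw [hF, Category.assoc, ← Functor.map_comp] at h1
      have h2 := (cancel_epi _).1 (h1.trans comp_zero.symm)
      have h3 : F ≫ M = 0 := (shiftFunctor T (1 : ℤ)).map_injective
        (h2.trans ((shiftFunctor T (1 : ℤ)).map_zero _ _).symm)
      have h4 : ∀ n, F ≫ pr n = 0 := by
        intro n
        induction n with
        | zero => rw [← M_pr0, ← Category.assoc, h3, zero_comp]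
        | succ n ih =>
          have h5 : F ≫ M ≫ pr (n + 1) = 0 := by rw [← Category.assoc, h3, zero_comp]
          rw [M_prs, Preadditive.comp_sub, ← Category.assoc F (pr n), ih, zero_comp, sub_zero] at h5
          exact h5
      obtain ⟨s, hs⟩ := sumform _ (compact_shift hD (-1)) F
      have h6 : F = 0 := by
        rw [hs]
        exact Finset.sum_eq_zero fun n _ => by rw [h4, zero_comp]
      rw [hF, h6, Functor.map_zero, comp_zero]
    obtain ⟨h, hh⟩ := Triangle.coyoneda_exact₃ _ hT f hfd
    change (g i)⟦m⟧ ⟶ ∐ U at h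
    change f = h ≫ c at hh
    obtain ⟨s, hs⟩ := sumform _ hD h
    rw [hh, hs, Preadditive.sum_comp]
    refine Finset.sum_eq_zero fun n _ => ?_
    rw [Category.assoc, inn_c, ← Category.assoc, ← Category.assoc]
    have := hφ1 (Xs n.down) i m (h ≫ pr n.down)
    change (h ≫ pr n.down) ≫ fs n.down = 0 at this
    rw [this, zero_comp, zero_comp]
  have key2 : ∀ f : C ⟶ Y, f = 0 := by
    have h1 : C ∈ {X : T | ∀ (m : ℤ) (f : X ⟶ Y⟦m⟧), f = 0} := by
      refine loc_min (orth_localizing Y) ?_ hCg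
      rintro _ ⟨i, rfl⟩ m f
      obtain ⟨F, hF⟩ := exists_unshift f
      rw [hF, key1 i (-m) F, Functor.map_zero, comp_zero]
    intro f
    have h2 := h1 0 (f ≫ (shiftFunctorZero T ℤ).inv.app Y)
    exact (cancel_mono _).1 (h2.trans zero_comp.symm)
  -- hence the map to some stage is zero
  have key3 : ∃ n, Φ n = 0 := by
    obtain ⟨k, hk⟩ := Triangle.coyoneda_exact₂ _ hT (inn 0) (key2 _)
    change C ⟶ ∐ U at k
    change inn 0 = k ≫ M at hk
    have h1 : ∀ n, k ≫ pr n = Φ n := by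
      intro n
      induction n with
      | zero =>
        rw [← M_pr0, ← Category.assoc, ← hk, inn_pr]
        rfl
      | succ n ih =>
        have h2 : inn 0 ≫ pr (n + 1) = 0 := inn_pr_ne 0 (n + 1) (by omega)
        rw [hk, Category.assoc, M_prs, Preadditive.comp_sub, sub_eq_zero, ← Category.assoc, ih] at h2
        exact h2
    obtain ⟨s, hs⟩ := sumform C hC k
    obtain ⟨⟨n⟩, hn⟩ := Infinite.exists_notMem_finset s
    refine ⟨n, ?_⟩
    rw [← h1, hs, Preadditive.sum_comp]
    refine Finset.sum_eq_zero fun m hm => ?_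
    have hmn : m.down ≠ n := fun h => hn (by rw [← h]; exact hm)
    have := inn_pr_ne m.down n hmn
    rw [Category.assoc, this, comp_zero]
  obtain ⟨n, hn⟩ := key3
  have key4 : ∀ (n : ℕ) (B : T) (a : B ⟶ C), IsCompactObj T B → ChainMap S a → a ≫ Φ n = 0 →
      C ∈ S := by
    intro n
    induction n with
    | zero =>
      intro B a _ ha h
      have h1 : a = 0 := by
        have : a ≫ 𝟙 C = 0 := h
        simpa using this
      apply ha.mem hS
      rw [h1]
      exact Fact.zero hS
    | succ n ih =>
      intro B a hB ha h
      have h1 : (a ≫ Φ n) ≫ φ (Xs n) = 0 := by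
        rw [Category.assoc]; exact h
      obtain ⟨D, x, y, hD, hxy⟩ := hφ2 (Xs n) B hB (a ≫ Φ n) h1
      obtain ⟨B', f, e, hT'⟩ := distinguished_cocone_triangle₁ x
      refine ih B' (f ≫ a) (compact_fst _ hT' hB (hSc _ hD)) (ChainMap.cons f x e hT' hD a ha) ?_
      have hfx : f ≫ x = 0 := comp_distTriang_mor_zero₁₂ _ hT'
      rw [Category.assoc, hxy, ← Category.assoc, hfx, zero_comp]
  exact key4 n C (𝟙 C) hC (ChainMap.id C) (by rw [hn, comp_zero])

end Neeman

end BIK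

namespace BIK

section Nak

variable {R : Type u} [Ring R] {𝒜 : ℤ → AddSubgroup R} [GradedRing 𝒜]
variable {T : Type u'} [Category.{v} T] [HasZeroObject T] [Preadditive T] [HasShift T ℤ]
  [∀ n : ℤ, (CategoryTheory.shiftFunctor T n).Additive] [Pretriangulated T]
  [HasCoproducts.{v} T] (A : CenterAction 𝒜 T)

/-- The action of homogeneous elements on `Hom*`, with flexible degrees. -/
def sm {i : ℤ} {a : R} (ha : a ∈ 𝒜 i) {X Y : T} {n m : ℤ} (f : X ⟶ Y⟦n⟧) (h : n + i = m) :
    X ⟶ Y⟦m⟧ :=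
  f ≫ A.act i a ha (Y⟦n⟧) ≫ (shiftFunctorAdd' T n i m h).inv.app Y

lemma act_congr {i : ℤ} {a b : R} (ha : a ∈ 𝒜 i) (hb : b ∈ 𝒜 i) (h : a = b) (X : T) :
    A.act i a ha X = A.act i b hb X := by
  subst h; rfl

lemma act_zero {i : ℤ} (h : (0 : R) ∈ 𝒜 i) (X : T) : A.act i 0 h X = 0 := by
  have h1 := A.act_add i 0 0 h h X
  rw [act_congr A (add_mem h h) h (add_zero 0)] at h1
  exact left_eq_add.1 h1

lemma act_neg {i : ℤ} {a : R} (ha : a ∈ 𝒜 i) (X : T) :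
    A.act i (-a) (neg_mem ha) X = - A.act i a ha X := by
  have h1 := A.act_add i (-a) a (neg_mem ha) ha X
  rw [act_congr A (add_mem (neg_mem ha) ha) (zero_mem _) (neg_add_cancel a), act_zero] at h1
  exact eq_neg_of_add_eq_zero_left h1.symm

lemma sm_congr {i j : ℤ} {a b : R} (ha : a ∈ 𝒜 i) (hb : b ∈ 𝒜 j) {X Y : T} {n m : ℤ}
    (f : X ⟶ Y⟦n⟧) (h : n + i = m) (h' : n + j = m) (hab : a = b) :
    sm A ha f h = sm A hb f h' := by
  obtain rfl : i = j := by omega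
  subst hab
  rfl

lemma sm_add_right {i : ℤ} {a : R} (ha : a ∈ 𝒜 i) {X Y : T} {n m : ℤ} (f g : X ⟶ Y⟦n⟧)
    (h : n + i = m) : sm A ha (f + g) h = sm A ha f h + sm A ha g h := by
  simp [sm]

lemma sm_sub_right {i : ℤ} {a : R} (ha : a ∈ 𝒜 i) {X Y : T} {n m : ℤ} (f g : X ⟶ Y⟦n⟧)
    (h : n + i = m) : sm A ha (f - g) h = sm A ha f h - sm A ha g h := by
  simp [sm]

lemma sm_neg_right {i : ℤ} {a : R} (ha : a ∈ 𝒜 i) {X Y : T} {n m : ℤ} (f : X ⟶ Y⟦n⟧)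
    (h : n + i = m) : sm A ha (-f) h = - sm A ha f h := by
  simp [sm]

lemma sm_zero_right {i : ℤ} {a : R} (ha : a ∈ 𝒜 i) {X Y : T} {n m : ℤ}
    (h : n + i = m) : sm A ha (0 : X ⟶ Y⟦n⟧) h = 0 := by
  simp [sm]

lemma sm_add_left {i : ℤ} {a b : R} (ha : a ∈ 𝒜 i) (hb : b ∈ 𝒜 i) {X Y : T} {n m : ℤ}
    (f : X ⟶ Y⟦n⟧) (h : n + i = m) :
    sm A (add_mem ha hb) f h = sm A ha f h + sm A hb f h := by
  simp [sm, A.act_add i a b ha hb]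

lemma sm_neg_left {i : ℤ} {a : R} (ha : a ∈ 𝒜 i) {X Y : T} {n m : ℤ}
    (f : X ⟶ Y⟦n⟧) (h : n + i = m) :
    sm A (neg_mem ha) f h = - sm A ha f h := by
  simp [sm, act_neg A ha]

lemma sm_zero_left {i : ℤ} (ha : (0 : R) ∈ 𝒜 i) {X Y : T} {n m : ℤ}
    (f : X ⟶ Y⟦n⟧) (h : n + i = m) :
    sm A ha f h = 0 := by
  simp [sm, act_zero A ha]

lemma sm_one {X Y : T} {n m : ℤ} (f : X ⟶ Y⟦n⟧) (h : n + 0 = m) :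
    sm A (SetLike.one_mem_graded 𝒜) f h = f ≫ eqToHom (by rw [← h, add_zero]) := by
  obtain rfl : n = m := by omega
  simp [sm, A.act_one, shiftFunctorAdd'_add_zero_inv_app]

lemma sm_one' {X Y : T} {n : ℤ} (f : X ⟶ Y⟦n⟧) :
    sm A (SetLike.one_mem_graded 𝒜) f (add_zero n) = f := by
  rw [sm_one]; simp

lemma sm_sm {i j : ℤ} {a b : R} (ha : a ∈ 𝒜 i) (hb : b ∈ 𝒜 j) {X Y : T} {n m k : ℤ}
    (f : X ⟶ Y⟦n⟧) (h : n + j = m) (h' : m + i = k) :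
    sm A ha (sm A hb f h) h' =
      sm A (SetLike.mul_mem_graded ha hb) f (by omega : n + (i + j) = k) := by
  unfold sm
  simp only [Category.assoc]
  rw [A.act_mul _ _ _ _ ha hb]
  rw [← Category.assoc ((shiftFunctorAdd' T n j m h).inv.app Y), A.act_natural]
  simp only [Category.assoc]
  rw [shiftFunctorAdd'_assoc_inv_app n j i m (i + j) k h (by omega) (by omega)]
  rfl

lemma sm_mul {i j l : ℤ} {a b : R} (ha : a ∈ 𝒜 i) (hb : b ∈ 𝒜 j) (hl : a * b ∈ 𝒜 l)
    {X Y : T} {n m k : ℤ}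
    (f : X ⟶ Y⟦n⟧) (h : n + j = m) (h' : m + i = k) (h'' : n + l = k) :
    sm A hl f h'' = sm A ha (sm A hb f h) h' := by
  rw [sm_sm]
  exact sm_congr A _ _ _ _ _ rfl

/-- Commutation up to sign. -/
lemma sm_comm (hcomm : IsGradedComm 𝒜) {i j : ℤ} {a b : R} (ha : a ∈ 𝒜 i) (hb : b ∈ 𝒜 j) :
    (a * b = b * a ∧ ∀ {X Y : T} {n m m' k : ℤ} (f : X ⟶ Y⟦n⟧) (h : n + j = m) (h' : m + i = k)
        (h2 : n + i = m') (h2' : m' + j = k),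
      sm A ha (sm A hb f h) h' = sm A hb (sm A ha f h2) h2') ∨
    (a * b = - (b * a) ∧ ∀ {X Y : T} {n m m' k : ℤ} (f : X ⟶ Y⟦n⟧) (h : n + j = m) (h' : m + i = k)
        (h2 : n + i = m') (h2' : m' + j = k),
      sm A ha (sm A hb f h) h' = - sm A hb (sm A ha f h2) h2') := by
  have h0 := hcomm i j a b ha hb
  rcases neg_one_pow_eq_or ℤ (i * j).natAbs with h1 | h1
  · rw [h1, one_smul] at h0
    refine Or.inl ⟨h0, ?_⟩
    intro X Y n m m' k f h h' h2 h2'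
    rw [sm_sm, sm_sm]
    exact sm_congr A _ _ _ _ _ h0
  · rw [h1, neg_smul, one_smul] at h0
    refine Or.inr ⟨h0, ?_⟩
    intro X Y n m m' k f h h' h2 h2'
    rw [sm_sm, sm_sm, ← sm_neg_left]
    exact sm_congr A _ _ _ _ _ h0

variable {A}

lemma HomSub.sm_mem {X Y : T} (S : HomSub A X Y) {i : ℤ} {a : R} (ha : a ∈ 𝒜 i) {n m : ℤ}
    (f : X ⟶ Y⟦n⟧) (h : n + i = m) (hf : f ∈ S.car n) : sm A ha f h ∈ S.car m := by
  subst h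
  exact S.hsmul_mem i a ha n f hf

/-- `p`-saturated submodules. -/
def HomSub.Sat {X Y : T} (S : HomSub A X Y) (p : SpecR 𝒜) : Prop :=
  ∀ {i : ℤ} {a : R} (ha : a ∈ 𝒜 i) {n m : ℤ} (f : X ⟶ Y⟦n⟧) (h : n + i = m),
    a ∉ p.1.toIdeal → sm A ha f h ∈ S.car m → f ∈ S.car n

/-- Membership in the `p`-saturation of `S + R g`. -/
def SatMem {X Y : T} (S : HomSub A X Y) (p : SpecR 𝒜) {n₀ : ℤ} (g : X ⟶ Y⟦n₀⟧) {n : ℤ}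
    (f : X ⟶ Y⟦n⟧) : Prop :=
  ∃ (i j m : ℤ) (u a : R) (hu : u ∈ 𝒜 i) (ha : a ∈ 𝒜 j) (h : n + i = m) (h' : n₀ + j = m),
    u ∉ p.1.toIdeal ∧ sm A hu f h - sm A ha g h' ∈ S.car m

lemma SatMem.add (hcomm : IsGradedComm 𝒜) {X Y : T} {S : HomSub A X Y} {p : SpecR 𝒜} {n₀ : ℤ}
    {g : X ⟶ Y⟦n₀⟧} {n : ℤ} {f f' : X ⟶ Y⟦n⟧} (hf : SatMem S p g f) (hf' : SatMem S p g f') :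
    SatMem S p g (f + f') := by
  obtain ⟨i, j, m, u, a, hu, ha, h, h', hup, H⟩ := hf
  obtain ⟨i', j', m', u', a', hu', ha', k, k', hup', H'⟩ := hf'
  have e1 := S.sm_mem hu' _ (rfl : m + i' = _) H
  have e2 := S.sm_mem hu _ (by omega : m' + i = m + i') H'
  have hj1 : u' * a ∈ 𝒜 (i' + j) := SetLike.mul_mem_graded hu' ha
  have hj2 : u * a' ∈ 𝒜 (i' + j) := by
    have := SetLike.mul_mem_graded (A := 𝒜) hu ha'
    rwa [show i + j' = i' + j by omega] at this
  rw [sm_sub_right] at e1 e2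
  rcases sm_comm A hcomm hu' hu with ⟨-, hc⟩ | ⟨-, hc⟩
  · refine ⟨i' + i, i' + j, m + i', u' * u, u' * a + u * a', SetLike.mul_mem_graded hu' hu,
      add_mem hj1 hj2, by omega, by omega, mul_not_mem p hu' hu hup' hup, ?_⟩
    rw [sm_mul A hu' hu _ (f + f') h rfl, sm_add_right, sm_add_right,
      sm_add_left A hj1 hj2, sm_mul A hu' ha hj1 g h' rfl, sm_mul A hu ha' hj2 g k' (by omega),
      hc f' h rfl k (by omega)]
    have := add_mem e1 e2
    convert this using 1
    abel
  · refine ⟨i' + i, i' + j, m + i', u' * u, u' * a + -(u * a'), SetLike.mul_mem_graded hu' hu,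
      add_mem hj1 (neg_mem hj2), by omega, by omega, mul_not_mem p hu' hu hup' hup, ?_⟩
    rw [sm_mul A hu' hu _ (f + f') h rfl, sm_add_right, sm_add_right,
      sm_add_left A hj1 (neg_mem hj2), sm_neg_left A hj2,
      sm_mul A hu' ha hj1 g h' rfl, sm_mul A hu ha' hj2 g k' (by omega),
      hc f' h rfl k (by omega)]
    have := sub_mem e1 e2
    convert this using 1
    abel

lemma SatMem.of_mem {X Y : T} {S : HomSub A X Y} {p : SpecR 𝒜} {n₀ : ℤ}
    {g : X ⟶ Y⟦n₀⟧} {n : ℤ} {f : X ⟶ Y⟦n⟧} (hf : f ∈ S.car n) : SatMem S p g f :=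
  ⟨0, n - n₀, n, 1, 0, SetLike.one_mem_graded 𝒜, zero_mem _, by omega, by omega, one_not_mem p, by
    rw [sm_zero_left, sub_zero, sm_one']; exact hf⟩

lemma SatMem.self {X Y : T} {S : HomSub A X Y} {p : SpecR 𝒜} {n₀ : ℤ}
    (g : X ⟶ Y⟦n₀⟧) : SatMem S p g g :=
  ⟨0, 0, n₀, 1, 1, SetLike.one_mem_graded 𝒜, SetLike.one_mem_graded 𝒜, by omega, by omega,
    one_not_mem p, by rw [sub_self]; exact zero_mem _⟩

lemma SatMem.neg {X Y : T} {S : HomSub A X Y} {p : SpecR 𝒜} {n₀ : ℤ}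
    {g : X ⟶ Y⟦n₀⟧} {n : ℤ} {f : X ⟶ Y⟦n⟧} (hf : SatMem S p g f) : SatMem S p g (-f) := by
  obtain ⟨i, j, m, u, a, hu, ha, h, h', hup, H⟩ := hf
  refine ⟨i, j, m, u, -a, hu, neg_mem ha, h, h', hup, ?_⟩
  rw [sm_neg_right, sm_neg_left A ha]
  convert neg_mem H using 1
  abel

lemma SatMem.sm (hcomm : IsGradedComm 𝒜) {X Y : T} {S : HomSub A X Y} {p : SpecR 𝒜} {n₀ : ℤ}
    {g : X ⟶ Y⟦n₀⟧} {n : ℤ} {f : X ⟶ Y⟦n⟧} (hf : SatMem S p g f)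
    {l m : ℤ} {b : R} (hb : b ∈ 𝒜 l) (hm : n + l = m) : SatMem S p g (sm A hb f hm) := by
  obtain ⟨i, j, m', u, a, hu, ha, h, h', hup, H⟩ := hf
  have e1 := S.sm_mem hb _ (rfl : m' + l = _) H
  have hba : b * a ∈ 𝒜 (l + j) := SetLike.mul_mem_graded hb ha
  rw [sm_sub_right] at e1
  rcases sm_comm A hcomm hu hb with ⟨-, hc⟩ | ⟨-, hc⟩
  · refine ⟨i, l + j, m' + l, u, b * a, hu, hba, by omega, by omega, hup, ?_⟩
    rw [hc f hm (by omega) h rfl, sm_mul A hb ha hba g h' rfl]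
    exact e1
  · refine ⟨i, l + j, m' + l, u, -(b * a), hu, neg_mem hba, by omega, by omega, hup, ?_⟩
    rw [hc f hm (by omega) h rfl, sm_neg_left A hba, sm_mul A hb ha hba g h' rfl]
    convert neg_mem e1 using 1
    abel

/-- The `p`-saturation of `S + R g`. -/
def satSub (hcomm : IsGradedComm 𝒜) {X Y : T} (S : HomSub A X Y) (p : SpecR 𝒜) {n₀ : ℤ}
    (g : X ⟶ Y⟦n₀⟧) : HomSub A X Y where
  car n :=
    { carrier := {f | SatMem S p g f}
      add_mem' := fun hf hf' => SatMem.add hcomm hf hf'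
      zero_mem' := SatMem.of_mem (zero_mem _)
      neg_mem' := fun hf => SatMem.neg hf }
  hsmul_mem i a ha n f hf := SatMem.sm hcomm hf ha rfl

lemma satSub_sat (hcomm : IsGradedComm 𝒜) {X Y : T} (S : HomSub A X Y) (p : SpecR 𝒜) {n₀ : ℤ}
    (g : X ⟶ Y⟦n₀⟧) : (satSub hcomm S p g).Sat p := by
  intro l b hb n m f h hbp H
  obtain ⟨i, j, m', u, a, hu, ha, k, k', hup, H⟩ := H
  refine ⟨i + l, j, m', u * b, a, SetLike.mul_mem_graded hu hb, ha, by omega, by omega,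
    mul_not_mem p hu hb hup hbp, ?_⟩
  rw [sm_mul A hu hb _ f h k]
  exact H

lemma nak_step (hcomm : IsGradedComm 𝒜) {X Y : T} (p : SpecR 𝒜) {i j : ℤ} {s t : R}
    (hs : s ∈ 𝒜 i) (hsp : s ∈ p.1.toIdeal) (ht : t ∈ 𝒜 j) (htp : t ∉ p.1.toIdeal)
    (H : ∀ (n : ℤ) (f : X ⟶ Y⟦n⟧), ∃ (m : ℤ) (h : m + i = n + j) (f' : X ⟶ Y⟦m⟧),
      sm A ht f rfl = sm A hs f' h)
    (S : HomSub A X Y) (hS : S.Sat p) {n₀ : ℤ} (g : X ⟶ Y⟦n₀⟧)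
    (hg : ∀ (n : ℤ) (f : X ⟶ Y⟦n⟧), SatMem S p g f) : g ∈ S.car n₀ := by
  obtain ⟨m, h, φ, hφ⟩ := H n₀ g
  obtain ⟨k, l, r, u, a, hu, ha, h1, h2, hup, H1⟩ := hg m φ
  have e1 := S.sm_mem hs _ (rfl : r + i = _) H1
  rw [sm_sub_right] at e1
  have hut : u * t ∈ 𝒜 (k + j) := SetLike.mul_mem_graded hu ht
  have hsa : s * a ∈ 𝒜 (k + j) := by
    have := SetLike.mul_mem_graded (A := 𝒜) hs ha
    rwa [show i + l = k + j by omega] at this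
  have hutp := mul_not_mem p hu ht hup htp
  have hsap : s * a ∈ p.1.toIdeal := by
    rcases sm_comm A hcomm hs ha with ⟨hc, -⟩ | ⟨hc, -⟩
    · rw [hc]; exact Ideal.mul_mem_left _ _ hsp
    · rw [hc]; exact neg_mem (Ideal.mul_mem_left _ _ hsp)
  rcases sm_comm A hcomm hs hu with ⟨-, hc⟩ | ⟨-, hc⟩
  · rw [hc φ h1 rfl h (by omega), ← hφ, ← sm_mul A hu ht hut g rfl _ (by omega),
      ← sm_mul A hs ha hsa g _ _ (by omega), sub_eq_add_neg, ← sm_neg_left, ← sm_add_left] at e1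
    refine hS _ g _ ?_ e1
    intro h3
    exact hutp (by simpa using sub_mem h3 (neg_mem hsap))
  · rw [hc φ h1 rfl h (by omega), ← hφ, ← sm_mul A hu ht hut g rfl _ (by omega),
      ← sm_mul A hs ha hsa g _ _ (by omega), sub_eq_add_neg, ← sm_neg_left, ← sm_neg_left,
      ← sm_add_left] at e1
    refine hS _ g _ ?_ e1
    intro h3
    exact hutp (by simpa using neg_mem (sub_mem h3 (neg_mem hsap)))

lemma nak (hcomm : IsGradedComm 𝒜) {X Y : T} (p : SpecR 𝒜) {i j : ℤ} {s t : R}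
    (hs : s ∈ 𝒜 i) (hsp : s ∈ p.1.toIdeal) (ht : t ∈ 𝒜 j) (htp : t ∉ p.1.toIdeal)
    (H : ∀ (n : ℤ) (f : X ⟶ Y⟦n⟧), ∃ (m : ℤ) (h : m + i = n + j) (f' : X ⟶ Y⟦m⟧),
      sm A ht f rfl = sm A hs f' h)
    (F : Finset ((n : ℤ) × (X ⟶ Y⟦n⟧))) :
    (∀ S : HomSub A X Y, S.Sat p → (∀ g ∈ F, g.2 ∈ S.car g.1) →
      ∀ (n : ℤ) (f : X ⟶ Y⟦n⟧), f ∈ S.car n) →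
    ∀ S : HomSub A X Y, S.Sat p → ∀ (n : ℤ) (f : X ⟶ Y⟦n⟧), f ∈ S.car n := by
  classical
  induction F using Finset.induction_on with
  | empty =>
    intro h S hS
    exact h S hS (by simp)
  | insert g F hgF ih =>
    intro hyp
    apply ih
    intro S hS hFS
    have h1 : g.2 ∈ S.car g.1 := by
      refine nak_step hcomm p hs hsp ht htp H S hS g.2 ?_
      refine hyp (satSub hcomm S p g.2) (satSub_sat hcomm S p g.2) ?_
      intro x hx
      rcases Finset.mem_insert.1 hx with rfl | hx
      · exact SatMem.self _
      · exact SatMem.of_mem (hFS x hx)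
    apply hyp S hS
    intro x hx
    rcases Finset.mem_insert.1 hx with rfl | hx
    · exact h1
    · exact hFS x hx

/-- The submodule of `p`-null morphisms. -/
def nullSub (A : CenterAction 𝒜 T) (p : SpecR 𝒜) (X Y : T) : HomSub A X Y where
  car n :=
    { carrier := {f | Null A p f}
      add_mem' := fun hf hf' => Null.add hf hf'
      zero_mem' := Null.zero p
      neg_mem' := fun {f} hf => by
        obtain ⟨i, s, hs, hp, h⟩ := hf
        exact ⟨i, s, hs, hp, by rw [Preadditive.neg_comp, h, neg_zero]⟩ }
  hsmul_mem i a ha n f hf := Null.comp_right hf _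

lemma nullSub_sat (p : SpecR 𝒜) (X Y : T) : (nullSub A p X Y).Sat p := by
  intro i a ha n m f h hp H
  have H' : Null A p (f ≫ A.act i a ha (Y⟦n⟧) ≫ (shiftFunctorAdd' T n i m h).inv.app Y) := H
  have h1 := H'.comp_right ((shiftFunctorAdd' T n i m h).hom.app Y)
  simp only [Category.assoc, Iso.inv_hom_id_app, Functor.comp_obj] at h1
  rw [Category.comp_id] at h1
  exact Null.of_comp_act ha hp h1

end Nak

end BIK

namespace BIK

section Koszul

variable {R : Type u} [Ring R] {𝒜 : ℤ → AddSubgroup R} [GradedRing 𝒜]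
variable {T : Type u'} [Category.{v} T] [HasZeroObject T] [Preadditive T] [HasShift T ℤ]
  [∀ n : ℤ, (CategoryTheory.shiftFunctor T n).Additive] [Pretriangulated T]
  [HasCoproducts.{v} T] {A : CenterAction 𝒜 T}

/-- The cone of the action of `s` is killed by `s²`. -/
lemma cone_kill {i : ℤ} {s : R} (hs : s ∈ 𝒜 i) {X W : T} {w : X⟦i⟧ ⟶ W} {d : W ⟶ X⟦(1 : ℤ)⟧}
    (hT : Triangle.mk (A.act i s hs X) w d ∈ distTriang T) :
    A.act (i + i) (s * s) (SetLike.mul_mem_graded hs hs) W = 0 := by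
  have h12 : A.act i s hs X ≫ w = 0 := comp_distTriang_mor_zero₁₂ _ hT
  have h31 : d ≫ (A.act i s hs X)⟦(1 : ℤ)⟧' = 0 := comp_distTriang_mor_zero₃₁ _ hT
  have h1 : w ≫ A.act i s hs W = 0 := by
    have hc : (shiftComm X i i).hom = 𝟙 (X⟦i⟧⟦i⟧) := by
      unfold shiftComm
      rw [shiftFunctorComm_eq_refl]
      rfl
    rw [A.act_natural, A.act_shift, hc, Category.comp_id, Preadditive.zsmul_comp,
      ← Functor.map_comp, h12, Functor.map_zero, smul_zero]
  obtain ⟨y, hy⟩ := Triangle.yoneda_exact₃ _ hT (A.act i s hs W) h1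
  change X⟦(1 : ℤ)⟧ ⟶ W⟦i⟧ at y
  change A.act i s hs W = d ≫ y at hy
  have h2 : A.act i s hs W ≫ A.act i s hs (W⟦i⟧) = 0 := by
    rw [hy, Category.assoc, A.act_natural, A.act_shift, Preadditive.zsmul_comp,
      Preadditive.comp_zsmul, Category.assoc, ← Category.assoc d, h31, zero_comp, smul_zero]
  rw [A.act_mul _ _ _ _ hs hs, ← Category.assoc, h2, zero_comp]

lemma cone_idNull {i : ℤ} {s : R} (hs : s ∈ 𝒜 i) {X W : T} {w : X⟦i⟧ ⟶ W} {d : W ⟶ X⟦(1 : ℤ)⟧}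
    (hT : Triangle.mk (A.act i s hs X) w d ∈ distTriang T) {q : SpecR 𝒜}
    (hq : s ∉ q.1.toIdeal) : IdNull A q W :=
  IdNull.iff.2 ⟨i + i, s * s, SetLike.mul_mem_graded hs hs, mul_not_mem q hs hs hq hq,
    cone_kill hs hT⟩

/-- Nakayama's lemma for Koszul objects. -/
lemma nakayama (hcomm : IsGradedComm 𝒜) {C : T} (hfg : FGHom A C C) {p : SpecR 𝒜}
    (hC : ¬ IdNull A p C) {i : ℤ} {s : R} (hs : s ∈ 𝒜 i) (hsp : s ∈ p.1.toIdeal) {W : T}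
    {w : C⟦-i⟧⟦i⟧ ⟶ W} {d : W ⟶ C⟦-i⟧⟦(1 : ℤ)⟧}
    (hT : Triangle.mk (A.act i s hs (C⟦-i⟧)) w d ∈ distTriang T) : ¬ IdNull A p W := by
  intro hW
  obtain ⟨j, t, ht, htp, hW⟩ := IdNull.iff.1 hW
  let e : C⟦-i⟧⟦i⟧ ≅ C := shiftNegShift C i
  obtain ⟨ψ, hψ⟩ := shift_exact₂ _ hT j (A.act j t ht (C⟦-i⟧⟦i⟧)) (by
    change A.act j t ht (C⟦-i⟧⟦i⟧) ≫ w⟦j⟧' = 0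
    rw [← A.act_natural, hW, comp_zero])
  change C⟦-i⟧⟦i⟧ ⟶ C⟦-i⟧⟦j⟧ at ψ
  change A.act j t ht (C⟦-i⟧⟦i⟧) = ψ ≫ (A.act i s hs (C⟦-i⟧))⟦j⟧' at hψ
  have key : ∃ (ψ' : C ⟶ C⟦-i⟧⟦j⟧) (ε : C⟦-i⟧⟦j⟧⟦i⟧ ⟶ C⟦j⟧),
      A.act j t ht C = ψ' ≫ A.act i s hs (C⟦-i⟧⟦j⟧) ≫ ε := by
    have h0 : A.act j t ht C = e.inv ≫ A.act j t ht (C⟦-i⟧⟦i⟧) ≫ e.hom⟦j⟧' := by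
      rw [← A.act_natural, Iso.inv_hom_id_assoc]
    have hsh := A.act_shift i s hs (C⟦-i⟧) j
    rcases neg_one_pow_eq_or ℤ (i * j).natAbs with h1 | h1
    · rw [h1, one_smul] at hsh
      refine ⟨e.inv ≫ ψ, (shiftComm (C⟦-i⟧) i j).inv ≫ e.hom⟦j⟧', ?_⟩
      rw [h0, hψ, hsh]
      simp
    · rw [h1, neg_smul, one_smul] at hsh
      refine ⟨e.inv ≫ ψ, -((shiftComm (C⟦-i⟧) i j).inv ≫ e.hom⟦j⟧'), ?_⟩
      rw [h0, hψ, hsh]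
      simp
  obtain ⟨ψ', ε, hact⟩ := key
  have H : ∀ (n : ℤ) (f : C ⟶ C⟦n⟧), ∃ (m : ℤ) (h : m + i = n + j) (f' : C ⟶ C⟦m⟧),
      sm A ht f rfl = sm A hs f' h := by
    intro n f
    have hm : (n + j - i) + i = n + j := by omega
    obtain ⟨κ, hκ⟩ := (shiftFunctor T i).map_surjective
      (X := C⟦-i⟧⟦j⟧) (Y := C⟦n + j - i⟧)
      (ε ≫ f⟦j⟧' ≫ (shiftFunctorAdd' T n j (n + j) rfl).inv.app C ≫
        (shiftFunctorAdd' T (n + j - i) i (n + j) hm).hom.app C)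
    refine ⟨n + j - i, hm, ψ' ≫ κ, ?_⟩
    unfold sm
    have h1 : (ψ' ≫ κ) ≫ A.act i s hs (C⟦n + j - i⟧) =
        ψ' ≫ A.act i s hs (C⟦-i⟧⟦j⟧) ≫ κ⟦i⟧' := by
      rw [Category.assoc, A.act_natural]
    rw [← Category.assoc (ψ' ≫ κ), h1, hκ, ← Category.assoc f, A.act_natural, hact]
    simp only [Category.assoc, Iso.hom_inv_id_app]
    erw [Category.comp_id]
  obtain ⟨F, hF⟩ := hfg
  have h1 := nak hcomm p hs hsp ht htp H F (fun S _ h => hF S h) (nullSub A p C C)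
    (nullSub_sat p C C) 0 ((shiftFunctorZero T ℤ).inv.app C)
  have h2 : Null A p ((shiftFunctorZero T ℤ).inv.app C) := h1
  apply hC
  have h3 := h2.comp_right ((shiftFunctorZero T ℤ).hom.app C)
  rw [Iso.inv_hom_id_app] at h3
  exact h3

lemma koszul_list (hcomm : IsGradedComm 𝒜) (hT : NoetherianT A) {p : SpecR 𝒜}
    (l : List ((i : ℤ) × 𝒜 i)) (hl : ∀ x ∈ l, (x.2 : R) ∈ p.1.toIdeal) :
    ∀ C : T, IsCompactObj T C → ¬ IdNull A p C →
      ∃ K : T, IsCompactObj T K ∧ K ∈ Loc T {C} ∧ ¬ IdNull A p K ∧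
        (∀ q : SpecR 𝒜, IdNull A q C → IdNull A q K) ∧
        ∀ q : SpecR 𝒜, ∀ x ∈ l, (x.2 : R) ∉ q.1.toIdeal → IdNull A q K := by
  induction l with
  | nil =>
    intro C hC hp
    exact ⟨C, hC, subset_loc _ rfl, hp, fun q h => h, by simp⟩
  | cons x l ih =>
    intro C hC hp
    obtain ⟨i, s, hs⟩ := x
    obtain ⟨W, w, d, hW⟩ := distinguished_cocone_triangle (A.act i s hs (C⟦-i⟧))
    have hWc : IsCompactObj T W :=
      compact_cone _ hW (compact_shift (compact_shift hC _) _) (compact_shift (compact_shift hC _) _)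
    have hWp : ¬ IdNull A p W := nakayama hcomm (hT C hC) hp hs (hl ⟨i, s, hs⟩ (by simp)) hW
    have hWq : ∀ q : SpecR 𝒜, IdNull A q C → IdNull A q W := fun q h =>
      IdNull.cone _ hW (h.shift _) ((h.shift _).shift _)
    have hWl : W ∈ Loc T {C} := by
      have h1 := loc_localizing (T := T) {C}
      have h2 : C ∈ Loc T {C} := subset_loc _ rfl
      exact h1.ext_mem _ hW (h1.shift_mem _ h2 _) (h1.shift_mem _ (h1.shift_mem _ h2 _) _)
    obtain ⟨K, hK, hKW, hKp, hKq, hKl⟩ := ih (fun x hx => hl x (by simp [hx])) W hWc hWp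
    refine ⟨K, hK, ?_, hKp, fun q h => hKq q (hWq q h), ?_⟩
    · exact loc_min (loc_localizing _) (by simpa using hWl) hKW
    · intro q y hy hyq
      rcases List.mem_cons.1 hy with rfl | hy
      · exact hKq q (cone_idNull hs hW hyq)
      · exact hKl q y hy hyq

lemma koszul_exists (hcomm : IsGradedComm 𝒜) (hnoeth : IsNoetherianRing R) (hT : NoetherianT A)
    {p : SpecR 𝒜} {C : T} (hC : IsCompactObj T C) (hp : ¬ IdNull A p C) :
    ∃ K : T, IsCompactObj T K ∧ K ∈ Loc T {C} ∧ ¬ IdNull A p K ∧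
      ∀ q : SpecR 𝒜, ¬ p.1.toIdeal ≤ q.1.toIdeal → IdNull A q K := by
  classical
  obtain ⟨G, hG⟩ := (isNoetherianRing_iff_ideal_fg R).1 hnoeth p.1.toIdeal
  let l : List ((i : ℤ) × 𝒜 i) := G.toList.flatMap fun g =>
    (DirectSum.decompose 𝒜 g).support.toList.map fun i => ⟨i, DirectSum.decompose 𝒜 g i⟩
  have hl : ∀ x ∈ l, (x.2 : R) ∈ p.1.toIdeal := by
    intro x hx
    obtain ⟨g, hg, hx⟩ := List.mem_flatMap.1 hx
    obtain ⟨i, hi, rfl⟩ := List.mem_map.1 hx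
    refine p.1.isHomogeneous i ?_
    change g ∈ p.1.toIdeal
    rw [← hG]
    exact Ideal.subset_span (by simpa using hg)
  obtain ⟨K, hK, hKC, hKp, -, hKl⟩ := koszul_list hcomm hT l hl C hC hp
  refine ⟨K, hK, hKC, hKp, fun q hq => ?_⟩
  by_contra hcon
  apply hq
  rw [← hG, Ideal.span_le]
  intro g hg
  change g ∈ q.1.toIdeal
  rw [← DirectSum.sum_support_decompose 𝒜 g]
  refine sum_mem fun i hi => ?_
  by_contra hgi
  refine hcon (hKl q ⟨i, DirectSum.decompose 𝒜 g i⟩ ?_ hgi)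
  exact List.mem_flatMap.2 ⟨g, by simpa using hg, List.mem_map.2 ⟨i, by simpa using hi, rfl⟩⟩

end Koszul

end BIK

namespace BIK

section Strat

variable {R : Type u} [Ring R] {𝒜 : ℤ → AddSubgroup R} [GradedRing 𝒜]
variable {T : Type u'} [Category.{v} T] [HasZeroObject T] [Preadditive T] [HasShift T ℤ]
  [∀ n : ℤ, (CategoryTheory.shiftFunctor T n).Additive] [Pretriangulated T]
  [HasCoproducts.{v} T] {A : CenterAction 𝒜 T} (B : BIKData A)

lemma specClosed_Zset (p : SpecR 𝒜) : SpecClosed (Zset p) :=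
  fun _ _ h h' h'' => h (h'.trans h'')

lemma specClosed_Vp (p : SpecR 𝒜) : SpecClosed (Vp p) :=
  fun _ _ h h' => le_trans h h'

lemma hom_to_L {V : Set (SpecR 𝒜)} (hV : SpecClosed V) {X Y : T} (hX : X ∈ TVset T A V)
    (f : X ⟶ (B.Lf V).obj Y) : f = 0 := by
  have h1 := (B.η V).naturality f
  have h2 : IsZero ((B.Lf V).obj X) := (B.kerL V hV X).2 hX
  have h3 : f ≫ (B.η V).app ((B.Lf V).obj Y) = 0 := by
    change (𝟭 T).map f ≫ (B.η V).app _ = 0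
    rw [h1, h2.eq_of_src ((B.Lf V).map f) 0, comp_zero]
  have h4 : IsIso ((B.η V).app ((B.Lf V).obj Y)) := by
    rw [← B.Lη_eq V hV]; exact B.Lη_iso V hV Y
  exact (cancel_mono _).1 (h3.trans zero_comp.symm)

lemma L_isZero_of_eta {V : Set (SpecR 𝒜)} (hV : SpecClosed V) {X : T}
    (h : (B.η V).app X = 0) : IsZero ((B.Lf V).obj X) := by
  have h1 := B.Lη_iso V hV X
  obtain ⟨Z, hZ⟩ := HasZeroObject.zero (C := T)
  have hLZ : IsZero ((B.Lf V).obj Z) := (B.kerL V hV Z).2 (TVset_zero hZ)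
  have h2 : (B.Lf V).map ((B.η V).app X) = 0 := by
    rw [h]
    have : (0 : (𝟭 T).obj X ⟶ (B.Lf V).obj X) = (0 : X ⟶ Z) ≫ (0 : Z ⟶ (B.Lf V).obj X) := by
      rw [comp_zero]
    rw [this]
    erw [Functor.map_comp]
    rw [hLZ.eq_of_src ((B.Lf V).map (0 : Z ⟶ (B.Lf V).obj X)) 0, comp_zero]
  rw [IsZero.iff_id_eq_zero]
  obtain ⟨k, hk, -⟩ := h1.out
  rw [h2, zero_comp] at hk
  exact hk.symm

lemma Γ_isZero {V : Set (SpecR 𝒜)} (hV : SpecClosed V) {X : T} (hX : IsZero X) :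
    IsZero ((B.Γ V).obj X) := by
  have h3 : IsZero ((B.Lf V).obj X) := (B.kerL V hV X).2 (TVset_zero hX)
  exact Triangle.isZero₁_of_isZero₂₃ _ (B.tri V hV X) hX h3

lemma ΓP_isZero {p : SpecR 𝒜} {X : T} (hX : X ∈ TVset T A (Zset p)) :
    IsZero ((B.ΓP p).obj X) :=
  Γ_isZero B (specClosed_Vp p) ((B.kerL _ (specClosed_Zset p) X).2 hX)

lemma ΓP_isZero_of_idNull {p : SpecR 𝒜} {X : T} (hX : IdNull A p X) :
    IsZero ((B.ΓP p).obj X) :=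
  ΓP_isZero B (TVset_of_idNull fun q hq => hX.mono (by simpa [Zset] using hq))

variable (A) in
/-- A compact object which looks like a Koszul object at `q`. -/
structure KosAt (q : SpecR 𝒜) (K : T) : Prop where
  compact : IsCompactObj T K
  not_null : ¬ IdNull A q K
  null : ∀ r : SpecR 𝒜, ¬ q.1.toIdeal ≤ r.1.toIdeal → IdNull A r K

lemma KosAt.not_van {q : SpecR 𝒜} {K : T} (hK : KosAt A q K) :
    ¬ Van A q K ((B.ΓP q).obj K) := by
  intro hvan
  have hZ := specClosed_Zset q
  have hV := specClosed_Vp q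
  have hKV : K ∈ TVset T A (Vp q) := TVset_of_idNull fun r hr => hK.null r hr
  obtain ⟨θ, hθ⟩ := Triangle.coyoneda_exact₂ _ (B.tri (Vp q) hV ((B.Lf (Zset q)).obj K))
    ((B.η (Zset q)).app K) (hom_to_L B hV hKV _)
  change K ⟶ (B.ΓP q).obj K at θ
  have hη : ∃ η : K ⟶ (B.Lf (Zset q)).obj K, η = (B.η (Zset q)).app K := ⟨_, rfl⟩
  obtain ⟨η, hη⟩ := hη
  have hθ' : ∃ γ : (B.ΓP q).obj K ⟶ (B.Lf (Zset q)).obj K, η = θ ≫ γ :=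
    ⟨(B.γ (Vp q)).app _, hη.trans hθ⟩
  obtain ⟨γ, hγ⟩ := hθ'
  have h1 : Null A q θ := by
    have := (hvan 0 ((shiftFunctorZero T ℤ).hom.app K ≫ θ)).comp_left
      ((shiftFunctorZero T ℤ).inv.app K)
    rwa [Iso.inv_hom_id_app_assoc] at this
  have h2 : Null A q η := by rw [hγ]; exact h1.comp_right γ
  obtain ⟨i, s, hs, hsq, h⟩ := h2
  rw [A.act_natural] at h
  obtain ⟨W, w, d, hW⟩ := distinguished_cocone_triangle (A.act i s hs K)
  obtain ⟨z, hz⟩ := Triangle.yoneda_exact₂ _ hW (η⟦i⟧') h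
  change W ⟶ ((B.Lf (Zset q)).obj K)⟦i⟧ at z
  change η⟦i⟧' = w ≫ z at hz
  have hWT : W ∈ TVset T A (Zset q) := TVset_of_idNull fun r hr => by
    refine cone_idNull hs hW fun hsr => hsq ?_
    have hr' : r.1.toIdeal ≤ q.1.toIdeal := by simpa [Zset] using hr
    exact hr' hsr
  obtain ⟨z', hz'⟩ := exists_unshift z
  have hz0 : z' = 0 := hom_to_L B hZ (TVset_shift hWT (-i)) z'
  rw [hz', hz0, Functor.map_zero, comp_zero, comp_zero] at hz
  have hη0 : η = 0 :=
    (shiftFunctor T i).map_injective (hz.trans ((shiftFunctor T i).map_zero _ _).symm)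
  have hL := L_isZero_of_eta B hZ (hη.symm.trans hη0)
  have hKT := (B.kerL _ hZ K).1 hL
  exact hK.not_null (idNull_of_TVset hK.compact hKT q (fun h => h le_rfl))

lemma KosAt.not_zero {q : SpecR 𝒜} {K : T} (hK : KosAt A q K) :
    ¬ IsZero ((B.ΓP q).obj K) :=
  fun h => hK.not_van B ((van_localizing q hK.compact).zero_mem _ h)

lemma inter_localizing {S S' : Set T} (h : IsLocalizing T S) (h' : IsLocalizing T S') :
    IsLocalizing T (S ∩ S') where
  zero_mem X hX := ⟨h.zero_mem X hX, h'.zero_mem X hX⟩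
  iso_mem e hX := ⟨h.iso_mem e hX.1, h'.iso_mem e hX.2⟩
  shift_mem X hX n := ⟨h.shift_mem X hX.1 n, h'.shift_mem X hX.2 n⟩
  ext_mem Tr hTr h1 h2 := ⟨h.ext_mem Tr hTr h1.1 h2.1, h'.ext_mem Tr hTr h1.2 h2.2⟩
  coprod_mem J f hf := ⟨h.coprod_mem J f fun j => (hf j).1, h'.coprod_mem J f fun j => (hf j).2⟩

variable {B}

lemma mem_image (q : SpecR 𝒜) (X : T) : (B.ΓP q).obj X ∈ B.ΓPImage q := ⟨X, ⟨Iso.refl _⟩⟩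

lemma minimal_of (hst : Stratified B) {q : SpecR 𝒜} {X : T} (hX : ¬ IsZero ((B.ΓP q).obj X)) :
    IsMinimalLoc (B.ΓPImage q) :=
  (hst.2 q).resolve_left fun h => hX (h _ (mem_image q X))

/-- If `Γ_q X ≠ 0` lies in a localizing subcategory, then so does all of `Γ_q T`. -/
lemma image_subset (hst : Stratified B) {q : SpecR 𝒜} {X : T} (hX : ¬ IsZero ((B.ΓP q).obj X))
    {S : Set T} (hS : IsLocalizing T S) (hXS : (B.ΓP q).obj X ∈ S) : B.ΓPImage q ⊆ S := by
  obtain ⟨h1, -, h3⟩ := minimal_of hst hX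
  rcases h3 _ (inter_localizing h1 hS) Set.inter_subset_left with h | h
  · exact absurd (h _ ⟨mem_image q X, hXS⟩) hX
  · intro Z hZ
    rw [← h] at hZ
    exact hZ.2

lemma ΓP_mem_loc (hst : Stratified B) (q : SpecR 𝒜) (X : T) : (B.ΓP q).obj X ∈ Loc T {X} := by
  rw [hst.1 X]
  exact subset_loc _ ⟨q, rfl⟩

lemma image_subset_loc (hst : Stratified B) {q : SpecR 𝒜} {X : T}
    (hX : ¬ IsZero ((B.ΓP q).obj X)) : B.ΓPImage q ⊆ Loc T {X} :=
  image_subset hst hX (loc_localizing _) (ΓP_mem_loc hst q X)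

lemma KosAt.isZero (hst : Stratified B) {q : SpecR 𝒜} {K : T} (hK : KosAt A q K) {Z : T}
    (hZ : Z ∈ B.ΓPImage q) (hv : Van A q K Z) : IsZero Z := by
  obtain ⟨h1, -, h3⟩ := minimal_of hst (hK.not_zero B)
  rcases h3 _ (inter_localizing h1 (van_localizing (A := A) q hK.compact))
    Set.inter_subset_left with h | h
  · exact h Z ⟨hZ, hv⟩
  · have h4 := mem_image (B := B) q K
    rw [← h] at h4
    exact absurd h4.2 (hK.not_van B)

lemma KosAt.act_isIso (hst : Stratified B) {q : SpecR 𝒜} {K : T} (hK : KosAt A q K) {Z : T}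
    (hZ : Z ∈ B.ΓPImage q) {i : ℤ} {s : R} (hs : s ∈ 𝒜 i) (hsq : s ∉ q.1.toIdeal) :
    IsIso (A.act i s hs Z) := by
  obtain ⟨W, w, d, hW⟩ := distinguished_cocone_triangle (A.act i s hs Z)
  have h1 := (minimal_of hst (hK.not_zero B)).1
  have hWG : W ∈ B.ΓPImage q := h1.ext_mem _ hW hZ (h1.shift_mem _ hZ _)
  have hW0 : IsZero W := hK.isZero hst hWG fun m g => (cone_idNull hs hW hsq).null_to g
  exact (Triangle.isZero₃_iff_isIso₁ _ hW).1 hW0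

lemma KosAt.hom_zero (hst : Stratified B) {q : SpecR 𝒜} {K : T} (hK : KosAt A q K) {Z X : T}
    (hZ : Z ∈ B.ΓPImage q) (hX : IdNull A q X) (f : X ⟶ Z) : f = 0 := by
  obtain ⟨i, s, hs, hsq, h⟩ := hX.null_from f
  have := hK.act_isIso hst hZ hs hsq
  exact (cancel_mono _).1 (h.trans zero_comp.symm)

lemma kos_orth (hst : Stratified B) {p q : SpecR 𝒜} (hpq : p ≠ q) {K L : T} (hK : KosAt A p K)
    (hL : KosAt A q L) {Z : T} (hZ : Z ∈ B.ΓPImage q) : Van A p K Z := by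
  by_cases h : p.1.toIdeal ≤ q.1.toIdeal
  · have h' : ¬ q.1.toIdeal ≤ p.1.toIdeal := fun h' =>
      hpq (Subtype.ext (HomogeneousIdeal.toIdeal_injective (le_antisymm h h')))
    have h1 : Van A p K L := fun m g => (hL.null p h').null_to g
    exact loc_min (van_localizing p hK.compact) (by simpa using h1)
      (image_subset_loc hst (hL.not_zero B) hZ)
  · intro m g
    rw [hL.hom_zero hst hZ ((hK.null q h).shift m) g]
    exact Null.zero p

lemma exists_kos (hcomm : IsGradedComm 𝒜) (hnoeth : IsNoetherianRing R) (hT : NoetherianT A)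
    {p : SpecR 𝒜} {C : T} (hC : IsCompactObj T C) (hp : ¬ IdNull A p C) :
    ∃ K : T, KosAt A p K ∧ K ∈ Loc T {C} := by
  obtain ⟨K, h1, h2, h3, h4⟩ := koszul_exists hcomm hnoeth hT hC hp
  exact ⟨K, ⟨h1, h3, h4⟩, h2⟩

/-- The support of a compact object. -/
lemma mem_supp_iff (hcomm : IsGradedComm 𝒜) (hnoeth : IsNoetherianRing R) (hT : NoetherianT A)
    (hst : Stratified B) {C : T} (hC : IsCompactObj T C) {p : SpecR 𝒜} :
    p ∈ B.suppObj C ↔ ¬ IdNull A p C := by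
  constructor
  · intro h h'
    exact h (ΓP_isZero_of_idNull B h')
  · intro h h0
    obtain ⟨K, hK, hKC⟩ := exists_kos hcomm hnoeth hT hC h
    have hloc := van_localizing (A := A) p hK.compact
    have h1 : ∀ q : SpecR 𝒜, Van A p K ((B.ΓP q).obj C) := by
      intro q
      by_cases hpq : p = q
      · subst hpq
        exact hloc.zero_mem _ h0
      · by_cases hq : IdNull A q C
        · exact hloc.zero_mem _ (ΓP_isZero_of_idNull B hq)
        · obtain ⟨L, hL, -⟩ := exists_kos hcomm hnoeth hT hC hq
          exact kos_orth hst hpq hK hL (mem_image q C)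
    have h2 : C ∈ {Z : T | Van A p K Z} := by
      have h3 : C ∈ Loc T {Y | ∃ p : SpecR 𝒜, Y = (B.ΓP p).obj C} := by
        rw [← hst.1 C]; exact subset_loc _ rfl
      refine loc_min hloc ?_ h3
      rintro _ ⟨q, rfl⟩
      exact h1 q
    have h4 : K ∈ {Z : T | Van A p K Z} := loc_min hloc (by simpa using h2) hKC
    have h5 := (h4 0 ((shiftFunctorZero T ℤ).hom.app K)).comp_left
      ((shiftFunctorZero T ℤ).inv.app K)
    rw [Iso.inv_hom_id_app] at h5
    exact hK.not_null h5

lemma exists_of_mem_suppT {p : SpecR 𝒜} (hp : p ∈ B.suppT) :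
    ∃ D : T, IsCompactObj T D ∧ ¬ IdNull A p D := by
  by_contra! hcon
  obtain ⟨X, hX⟩ := hp
  apply hX
  apply ΓP_isZero
  rw [mem_TVset]
  intro C hC q hq m g
  have hq' : q.1.toIdeal ≤ p.1.toIdeal := by simpa [Zset] using hq
  exact (((hcon C hC).mono hq').shift m).null_from g

lemma mem_suppSet {S : Set T} {p : SpecR 𝒜} : p ∈ B.suppSet S ↔ ∃ X ∈ S, p ∈ B.suppObj X := by
  simp [BIKData.suppSet]

end Strat

end BIK

open BIK in
/-- Theorem (classification of thick subcategories of compact objects). -/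
theorem statement_9
{R : Type u} [Ring R] (𝒜 : ℤ → AddSubgroup R) [GradedRing 𝒜]
    (hcomm : IsGradedComm 𝒜) (hnoeth : IsNoetherianRing R)
    {T : Type u'} [Category.{v} T] [HasZeroObject T] [Preadditive T] [HasShift T ℤ]
    [∀ n : ℤ, (CategoryTheory.shiftFunctor T n).Additive] [Pretriangulated T]
    [HasCoproducts.{v} T]
    (hgen : CompactlyGen T)
    (A : CenterAction 𝒜 T) (B : BIKData A)
    (hT : NoetherianT A) (hst : Stratified B) :
    (∀ S : Set T, IsThick T S → (∀ C ∈ S, IsCompactObj T C) →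
        B.suppSet S ⊆ B.suppT ∧ SpecClosed (B.suppSet S)) ∧
    (∀ S S' : Set T, IsThick T S → (∀ C ∈ S, IsCompactObj T C) →
        IsThick T S' → (∀ C ∈ S', IsCompactObj T C) →
        B.suppSet S = B.suppSet S' → S = S') ∧
    (∀ V : Set (SpecR 𝒜), V ⊆ B.suppT → SpecClosed V →
        IsThick T {C : T | IsCompactObj T C ∧ B.suppObj C ⊆ V} ∧
        B.suppSet {C : T | IsCompactObj T C ∧ B.suppObj C ⊆ V} = V) ∧
    (∀ S : Set T, IsThick T S → (∀ C ∈ S, IsCompactObj T C) →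
        {C : T | IsCompactObj T C ∧ B.suppObj C ⊆ B.suppSet S} = S) := by
  have hsup : ∀ {C : T}, IsCompactObj T C → ∀ {p : SpecR 𝒜}, p ∈ B.suppObj C ↔ ¬ IdNull A p C :=
    fun hC => mem_supp_iff hcomm hnoeth hT hst hC
  have part4 : ∀ S : Set T, IsThick T S → (∀ C ∈ S, IsCompactObj T C) →
      {C : T | IsCompactObj T C ∧ B.suppObj C ⊆ B.suppSet S} = S := by
    intro S hS hSc
    apply Set.Subset.antisymm
    · rintro C ⟨hC, hCS⟩
      refine neeman hS hSc hC ?_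
      have h3 : C ∈ Loc T {Y | ∃ p : SpecR 𝒜, Y = (B.ΓP p).obj C} := by
        rw [← hst.1 C]; exact subset_loc _ rfl
      refine loc_min (loc_localizing S) ?_ h3
      rintro _ ⟨p, rfl⟩
      by_cases hp : IsZero ((B.ΓP p).obj C)
      · exact (loc_localizing S).zero_mem _ hp
      · obtain ⟨D, hD, hpD⟩ := mem_suppSet.1 (hCS (a := p) hp)
        have h5 : D ∈ Loc T S := subset_loc S hD
        exact loc_min (loc_localizing S) (by simpa using h5)
          (image_subset_loc hst hpD (mem_image p C))
    · intro C hC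
      exact ⟨hSc C hC, fun p hp => mem_suppSet.2 ⟨C, hC, hp⟩⟩
  refine ⟨?_, ?_, ?_, part4⟩
  · intro S hS hSc
    refine ⟨?_, ?_⟩
    · intro p hp
      obtain ⟨X, -, hX⟩ := mem_suppSet.1 hp
      exact ⟨X, hX⟩
    · intro p q hp hpq
      obtain ⟨X, hXS, hX⟩ := mem_suppSet.1 hp
      refine mem_suppSet.2 ⟨X, hXS, ?_⟩
      rw [hsup (hSc X hXS)] at hX ⊢
      exact fun h => hX (h.mono hpq)
  · intro S S' hS hSc hS' hSc' h
    rw [← part4 S hS hSc, ← part4 S' hS' hSc', h]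
  · intro V hV hVc
    have hmem : ∀ C : T, C ∈ {C : T | IsCompactObj T C ∧ B.suppObj C ⊆ V} ↔
        IsCompactObj T C ∧ ∀ p ∉ V, IdNull A p C := by
      intro C
      constructor
      · rintro ⟨hC, h⟩
        refine ⟨hC, fun p hp => ?_⟩
        by_contra hcon
        exact hp (h ((hsup hC).2 hcon))
      · rintro ⟨hC, h⟩
        refine ⟨hC, fun p hp => ?_⟩
        by_contra hcon
        exact (hsup hC).1 hp (h p hcon)
    constructor
    · constructor
      · intro X hX
        exact (hmem X).2 ⟨compact_zero hX, fun p _ => IdNull.of_isZero hX⟩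
      · intro X Y e hX
        obtain ⟨h1, h2⟩ := (hmem X).1 hX
        exact (hmem Y).2 ⟨compact_iso e h1, fun p hp => (h2 p hp).retract e.inv e.hom e.inv_hom_id⟩
      · intro X hX n
        obtain ⟨h1, h2⟩ := (hmem X).1 hX
        exact (hmem _).2 ⟨compact_shift h1 n, fun p hp => (h2 p hp).shift n⟩
      · intro Tr hTr hX hY
        obtain ⟨h1, h2⟩ := (hmem _).1 hX
        obtain ⟨h3, h4⟩ := (hmem _).1 hY
        exact (hmem _).2 ⟨compact_cone Tr hTr (compact_shift h1 1) h3,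
          fun p hp => IdNull.cone Tr hTr (h2 p hp) (h4 p hp)⟩
      · intro X Y hY i r hir
        obtain ⟨h1, h2⟩ := (hmem Y).1 hY
        exact (hmem X).2 ⟨compact_retract h1 i r hir, fun p hp => (h2 p hp).retract i r hir⟩
    · apply Set.Subset.antisymm
      · intro p hp
        obtain ⟨X, hXS, hX⟩ := mem_suppSet.1 hp
        exact hXS.2 hX
      · intro p hp
        obtain ⟨D, hD, hDp⟩ := exists_of_mem_suppT (hV hp)
        obtain ⟨K, hK, -⟩ := exists_kos hcomm hnoeth hT hD hDp
        refine mem_suppSet.2 ⟨K, (hmem K).2 ⟨hK.compact, fun q hq => hK.null q fun h => ?_⟩,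
          (hsup hK.compact).2 hK.not_null⟩
        exact hq (hVc p q hp h)
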